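/- arXiv:2405.14395 — 5 statements merged into one kernel-verified Lean document; each statement's English description precedes it below -/
import Mathlib

section
/- Let s₀, s₁ ∈ S be distinct simple reflections and define s_{n+1} = w_{S∖{s_n}} s_{n−1} w_{S∖{s_n}} for n ≥ 1. Then there exists a unique integer m ≥ 1 such that w'₀ w_S = (w'₀w₁)(w'₁w₂)⋯(w'_{m−1}w_m) and the lengths add: ℓ(w'₀ w_S) = Σ_{j=1}^m ℓ(w'_{j−1} w_j). Here w_n = w_{S∖{s_n}} and w'_n = w_{S∖{s_n, s_{n+1}}}. (Luo's decomposition theorem.) -/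
namespace Luo

open CoxeterSystem

variable {B W : Type*} [Group W] {M : CoxeterMatrix B} (cs : CoxeterSystem M W)

open Classical in
noncomputable def act (i : B) : Function.End (W × ZMod 2) :=
  fun p => (cs.simple i * p.1 * cs.simple i, p.2 + if p.1 = cs.simple i then 1 else 0)

theorem end_mul {α : Type*} (f g : Function.End α) (p : α) : (f * g) p = f (g p) := rfl

open Classical in
theorem act_pow (i j : B) (n : ℕ) (p : W × ZMod 2) :
    ((act cs i * act cs j) ^ n : Function.End (W × ZMod 2)) p =
      ((cs.simple i * cs.simple j) ^ n * p.1 * ((cs.simple i * cs.simple j) ^ n)⁻¹,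
        p.2 + ∑ k ∈ Finset.range (2 * n),
          if (cs.simple i * cs.simple j) ^ k * p.1 = cs.simple j then 1 else 0) := by
  induction n with
  | zero => simp [Function.End.one_def]
  | succ n ih =>
    rw [pow_succ', end_mul, ih, end_mul]
    set a := cs.simple i with ha
    set b := cs.simple j with hb
    have haa : a * a = 1 := cs.simple_mul_simple_self i
    have hbb : b * b = 1 := cs.simple_mul_simple_self j
    have hai : a⁻¹ = a := cs.inv_simple i
    have hbi : b⁻¹ = b := cs.inv_simple j
    have hr : b * (a * b) ^ n = ((a * b) ^ n)⁻¹ * b := by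
      have h1 : b * (a * b) * b⁻¹ = (a * b)⁻¹ := by
        rw [mul_inv_rev, hai, hbi, mul_assoc, mul_assoc, hbb, mul_one]
      have h2 : (b * (a * b) * b⁻¹) ^ n = b * (a * b) ^ n * b⁻¹ := conj_pow
      rw [h1, inv_pow] at h2
      rw [h2]; group
    have e1 : (a * b) ^ n * p.1 * ((a * b) ^ n)⁻¹ = b ↔ (a * b) ^ (2 * n) * p.1 = b := by
      rw [mul_inv_eq_iff_eq_mul, hr, eq_inv_mul_iff_mul_eq, ← mul_assoc, ← pow_add, ← two_mul]
    have e2 : b * ((a * b) ^ n * p.1 * ((a * b) ^ n)⁻¹) * b = a ↔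
        (a * b) ^ (2 * n + 1) * p.1 = b := by
      have : b * ((a * b) ^ n * p.1 * ((a * b) ^ n)⁻¹) * b = a ↔
          (a * b) ^ (n + 1) * p.1 * ((a * b) ^ n)⁻¹ = b := by
        rw [pow_succ']
        constructor
        · intro h
          calc _ = a * (b * ((a * b) ^ n * p.1 * ((a * b) ^ n)⁻¹) * b) * b⁻¹ := by group
            _ = b := by rw [h, haa, one_mul, hbi]
        · intro h
          calc _ = a⁻¹ * (a * b * (a * b) ^ n * p.1 * ((a * b) ^ n)⁻¹) * b := by
                generalize (a * b) ^ n = q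
                group
            _ = a := by rw [h, mul_assoc, hbb, mul_one, hai]
      rw [this, mul_inv_eq_iff_eq_mul, hr, eq_inv_mul_iff_mul_eq, ← mul_assoc, ← pow_add,
        two_mul, add_assoc]
    simp only [act, ← ha, ← hb]
    rw [show 2 * (n + 1) = 2 * n + 1 + 1 by ring, Finset.sum_range_succ, Finset.sum_range_succ]
    simp only [e1, e2, Prod.mk.injEq]
    constructor
    · rw [pow_succ' (a * b) n, mul_inv_rev, mul_inv_rev, hai, hbi]
      simp only [mul_assoc]
    · ring

theorem act_liftable : M.IsLiftable (act cs) := by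
  intro i j
  funext p
  rw [act_pow]
  have h := cs.simple_mul_simple_pow i j
  generalize M i j = m at h ⊢
  have hx : ∀ x, (cs.simple i * cs.simple j) ^ (m + x) = (cs.simple i * cs.simple j) ^ x := by
    intro x; rw [pow_add, h, one_mul]
  show _ = p
  rw [two_mul, Finset.sum_range_add]
  have hy : ∀ f g : ℕ → ZMod 2, (∀ x, g x = f x) →
      ∑ x ∈ Finset.range m, f x + ∑ x ∈ Finset.range m, g x = 0 := by
    intro f g hfg
    rw [Finset.sum_congr rfl (fun x _ => hfg x), ← two_mul, show (2 : ZMod 2) = 0 from rfl,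
      zero_mul]
  rw [h, hy _ _ (fun x => by rw [hx x])]
  simp

noncomputable def actHom : W →* Function.End (W × ZMod 2) := cs.lift ⟨act cs, act_liftable cs⟩

open Classical in
theorem actHom_word (ω : List B) (p : W × ZMod 2) :
    actHom cs (cs.wordProd ω) p =
      (cs.wordProd ω * p.1 * (cs.wordProd ω)⁻¹, p.2 + ((cs.rightInvSeq ω).count p.1 : ZMod 2)) := by
  induction ω with
  | nil => simp [Function.End.one_def]
  | cons i ω ih =>
    rw [wordProd_cons, map_mul, end_mul, ih]
    have : actHom cs (cs.simple i) = act cs i := cs.lift_apply_simple _ i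
    rw [this, act]
    simp only [rightInvSeq, List.count_cons, mul_inv_rev, inv_simple, mul_assoc, Prod.mk.injEq,
      true_and]
    have e : (cs.wordProd ω * (p.1 * (cs.wordProd ω)⁻¹) = cs.simple i) ↔
        ((cs.wordProd ω)⁻¹ * (cs.simple i * cs.wordProd ω) == p.1) = true := by
      rw [beq_iff_eq]
      constructor
      · intro h; rw [← h]; group
      · intro h; rw [← h]; group
    by_cases h : cs.wordProd ω * (p.1 * (cs.wordProd ω)⁻¹) = cs.simple i
    · rw [if_pos h, if_pos (e.1 h)]; push_cast; ring
    · rw [if_neg h, if_neg (fun h' => h (e.2 h'))]; push_cast; ring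

open Classical in
theorem mem_ris (ω : List B) (i : B)
    (h : cs.length (cs.wordProd ω * cs.simple i) < cs.length (cs.wordProd ω)) :
    cs.simple i ∈ cs.rightInvSeq ω := by
  by_contra hn
  obtain ⟨μ, hμ, e⟩ := cs.exists_isReduced (cs.wordProd ω * cs.simple i)
  have h1 := actHom_word cs μ (cs.simple i, 0)
  rw [← e, map_mul, end_mul] at h1
  have : actHom cs (cs.simple i) = act cs i := cs.lift_apply_simple _ i
  rw [this, act] at h1
  simp only [actHom_word, Prod.mk.injEq] at h1
  have h2 := h1.2
  simp only [simple_mul_simple_self, one_mul, if_true, List.count_eq_zero_of_not_mem hn] at h2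
  by_cases hm : cs.simple i ∈ cs.rightInvSeq μ
  · have := (cs.isRightInversion_of_mem_rightInvSeq hμ hm).2
    rw [← e] at this
    simp at this
    omega
  · rw [List.count_eq_zero_of_not_mem hm] at h2
    simp at h2

theorem exch (ω : List B) (i : B)
    (h : cs.length (cs.simple i * cs.wordProd ω) < cs.length (cs.wordProd ω)) :
    ∃ j < ω.length, cs.simple i * cs.wordProd ω = cs.wordProd (ω.eraseIdx j) := by
  have h1 : cs.simple i ∈ cs.rightInvSeq ω.reverse := by
    apply mem_ris
    rw [wordProd_reverse, length_inv, ← length_inv]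
    simpa using h
  rw [rightInvSeq_reverse, List.mem_reverse, List.mem_iff_getElem] at h1
  obtain ⟨j, hj, e⟩ := h1
  refine ⟨j, by simpa using hj, ?_⟩
  rw [← cs.getD_leftInvSeq_mul_wordProd, List.getD_eq_getElem _ _ hj, e]

variable {cs}

theorem word_mem {J : Set W} {ω : List B} (h : ∀ i ∈ ω, cs.simple i ∈ J) :
    cs.wordProd ω ∈ Subgroup.closure J := by
  induction ω with
  | nil => simp
  | cons i ω ih =>
    rw [wordProd_cons]
    exact mul_mem (Subgroup.subset_closure (h i (by simp)))
      (ih fun k hk => h k (by simp [hk]))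

theorem red_word {J : Set W} (ω : List B) (h : ∀ i ∈ ω, cs.simple i ∈ J) :
    ∃ ω', (∀ i ∈ ω', cs.simple i ∈ J) ∧ cs.IsReduced ω' ∧ cs.wordProd ω' = cs.wordProd ω := by
  induction ω with
  | nil => exact ⟨[], by simp, by simp [CoxeterSystem.IsReduced], rfl⟩
  | cons i ω ih =>
    obtain ⟨μ, h1, h2, h3⟩ := ih fun k hk => h k (by simp [hk])
    rw [wordProd_cons, ← h3]
    rcases cs.length_simple_mul (cs.wordProd μ) i with hl | hl
    · refine ⟨i :: μ, ?_, ?_, wordProd_cons _ _ _⟩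
      · intro k hk
        rcases List.mem_cons.1 hk with rfl | hk
        · exact h _ (by simp)
        · exact h1 k hk
      · rw [CoxeterSystem.IsReduced, wordProd_cons, hl, h2.eq]; simp
    · obtain ⟨j, hj, e⟩ := exch cs μ i (by omega)
      refine ⟨μ.eraseIdx j, fun k hk => h1 k (List.mem_of_mem_eraseIdx hk), ?_, e.symm⟩
      rw [CoxeterSystem.IsReduced, ← e, List.length_eraseIdx_of_lt hj]
      have := h2.eq
      omega

theorem par_word {J : Set W} (hJ : J ⊆ Set.range cs.simple) {v : W}
    (hv : v ∈ Subgroup.closure J) :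
    ∃ ω, (∀ i ∈ ω, cs.simple i ∈ J) ∧ cs.IsReduced ω ∧ cs.wordProd ω = v := by
  suffices h : ∃ ω, (∀ i ∈ ω, cs.simple i ∈ J) ∧ cs.wordProd ω = v by
    obtain ⟨ω, h1, rfl⟩ := h
    exact red_word ω h1
  induction hv using Subgroup.closure_induction with
  | mem x hx =>
    obtain ⟨i, rfl⟩ := hJ hx
    exact ⟨[i], by simpa using hx, by simp⟩
  | one => exact ⟨[], by simp, by simp⟩
  | mul x y _ _ hx hy =>
    obtain ⟨a, h1, rfl⟩ := hx
    obtain ⟨b, h2, rfl⟩ := hy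
    refine ⟨a ++ b, ?_, wordProd_append _ _ _⟩
    intro i hi
    rcases List.mem_append.1 hi with hi | hi
    · exact h1 i hi
    · exact h2 i hi
  | inv x _ hx =>
    obtain ⟨a, h1, rfl⟩ := hx
    exact ⟨a.reverse, by simpa using h1, by simp⟩

theorem mem_of_len_one {J : Set W} (hJ : J ⊆ Set.range cs.simple) {v : W}
    (hv : v ∈ Subgroup.closure J) (h : cs.length v = 1) : v ∈ J := by
  obtain ⟨ω, h1, h2, rfl⟩ := par_word hJ hv
  rw [h2.eq] at h
  obtain ⟨i, rfl⟩ := List.length_eq_one_iff.1 h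
  simpa using h1 i (by simp)

theorem par_lt {J : Set W} (hJ : J ⊆ Set.range cs.simple) {v t : W}
    (hv : v ∈ Subgroup.closure J) (ht : t ∈ Set.range cs.simple) (htJ : t ∉ J) :
    cs.length (t * v) = cs.length v + 1 := by
  obtain ⟨i, rfl⟩ := ht
  obtain ⟨ω, h1, h2, rfl⟩ := par_word hJ hv
  rcases cs.length_simple_mul (cs.wordProd ω) i with hl | hl
  · exact hl
  · obtain ⟨j, hj, e⟩ := exch cs ω i (by omega)
    exfalso
    apply htJ
    refine mem_of_len_one hJ ?_ (cs.length_simple i)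
    have h3 : cs.simple i * cs.wordProd ω ∈ Subgroup.closure J := by
      rw [e]; exact word_mem fun k hk => h1 k (List.mem_of_mem_eraseIdx hk)
    simpa using mul_mem h3 (inv_mem hv)

theorem desc {J : Set W} (hJ : J ⊆ Set.range cs.simple) {x : W}
    (hx : ∀ t ∈ J, cs.length (t * x) < cs.length x) {v : W} (hv : v ∈ Subgroup.closure J) :
    cs.length (v⁻¹ * x) + cs.length v = cs.length x := by
  obtain ⟨ω, h1, h2, rfl⟩ := par_word hJ hv
  clear hv
  induction ω with
  | nil => simp
  | cons i ω ih =>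
    have hr : cs.IsReduced ω := by simpa using h2.drop 1
    have ih := ih (fun k hk => h1 k (by simp [hk])) hr
    have hlen := h2.eq
    rw [wordProd_cons] at hlen
    simp only [List.length_cons] at hlen
    rw [hr.eq] at ih
    obtain ⟨μ, hμ, e⟩ := cs.exists_isReduced ((cs.wordProd ω)⁻¹ * x)
    have ex : x = cs.wordProd (ω ++ μ) := by rw [wordProd_append, ← e]; group
    have hd := hx _ (h1 i (by simp))
    nth_rw 1 2 [ex] at hd
    obtain ⟨j, hj, e2⟩ := exch cs _ i hd
    rw [← ex] at e2
    rw [e, hμ.eq] at ih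
    rcases lt_or_ge j ω.length with hjl | hjl
    · exfalso
      rw [List.eraseIdx_append_of_lt_length hjl, wordProd_append, ex, wordProd_append,
        ← mul_assoc] at e2
      have e3 := mul_right_cancel e2
      rw [e3] at hlen
      have := cs.length_wordProd_le (ω.eraseIdx j)
      rw [List.length_eraseIdx_of_lt hjl] at this
      omega
    · rw [List.eraseIdx_append_of_length_le hjl, wordProd_append] at e2
      have e3 : (cs.wordProd (i :: ω))⁻¹ * x = cs.wordProd (μ.eraseIdx (j - ω.length)) := by
        rw [wordProd_cons, mul_inv_rev, inv_simple, mul_assoc, e2]; group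
      have h5 := cs.length_wordProd_le (μ.eraseIdx (j - ω.length))
      rw [List.length_append] at hj
      rw [List.length_eraseIdx_of_lt (by omega), ← e3] at h5
      have h6 := cs.length_mul_le (cs.wordProd (i :: ω)) ((cs.wordProd (i :: ω))⁻¹ * x)
      rw [mul_inv_cancel_left] at h6
      have h7 := h2.eq
      simp only [List.length_cons] at h7
      omega

variable (cs) in
structure IsL (J : Set W) (w : W) : Prop where
  sub : J ⊆ Set.range cs.simple
  mem : w ∈ Subgroup.closure J
  max : ∀ u ∈ Subgroup.closure J, cs.length u ≤ cs.length w

namespace IsL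

variable {J : Set W} {w : W}

theorem lt (h : IsL cs J w) {t : W} (ht : t ∈ J) : cs.length (t * w) < cs.length w := by
  have h1 := h.max (t * w) (mul_mem (Subgroup.subset_closure ht) h.mem)
  obtain ⟨i, rfl⟩ := h.sub ht
  have := cs.length_simple_mul_ne w i
  omega

theorem L1 (h : IsL cs J w) {v : W} (hv : v ∈ Subgroup.closure J) :
    cs.length (v⁻¹ * w) + cs.length v = cs.length w := desc h.sub (fun _ ht => h.lt ht) hv

theorem uniq (h : IsL cs J w) {v : W} (hv : v ∈ Subgroup.closure J)
    (hl : cs.length w ≤ cs.length v) : v = w := by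
  have h1 := h.L1 hv
  have h2 : cs.length (v⁻¹ * w) = 0 := by omega
  rw [length_eq_zero_iff, inv_mul_eq_one] at h2
  exact h2

theorem inv (h : IsL cs J w) : w⁻¹ = w := h.uniq (inv_mem h.mem) (by simp)

theorem mul_self (h : IsL cs J w) : w * w = 1 := by
  nth_rw 1 [← h.inv]; simp

theorem L1' (h : IsL cs J w) {v : W} (hv : v ∈ Subgroup.closure J) :
    cs.length (v * w) + cs.length v = cs.length w := by
  simpa using h.L1 (inv_mem hv)

theorem conj_len (h : IsL cs J w) {v : W} (hv : v ∈ Subgroup.closure J) :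
    cs.length (w * v * w) = cs.length v := by
  have h1 := h.L1' hv
  have h2 := h.L1 (mul_mem hv h.mem)
  have h3 : cs.length ((v * w)⁻¹ * w) = cs.length (w * v * w) := by
    rw [← length_inv]
    simp [h.inv, mul_assoc]
  omega

theorem conj_mem (h : IsL cs J w) {t : W} (ht : t ∈ J) : w * t * w ∈ J := by
  have ht' := Subgroup.subset_closure (k := J) ht
  apply mem_of_len_one h.sub (mul_mem (mul_mem h.mem ht') h.mem)
  rw [h.conj_len ht']
  obtain ⟨i, rfl⟩ := h.sub ht
  simp

theorem conj_conj (h : IsL cs J w) (t : W) : w * (w * t * w) * w = t := by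
  have := h.mul_self
  calc _ = (w * w) * t * (w * w) := by group
    _ = t := by simp [this]

theorem conj_cl (h : IsL cs J w) {a v : W}
    (hv : v ∈ Subgroup.closure (J \ {a})) :
    w * v * w ∈ Subgroup.closure (J \ {w * a * w}) := by
  have : v ∈ (Subgroup.closure (J \ {w * a * w})).comap (MulAut.conj w).toMonoidHom := by
    refine (Subgroup.closure_le _).2 ?_ hv
    rintro t ⟨ht, hta⟩
    simp only [Subgroup.coe_comap, Set.mem_preimage, MulEquiv.coe_toMonoidHom,
      MulAut.conj_apply, SetLike.mem_coe, h.inv]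
    refine Subgroup.subset_closure ⟨h.conj_mem ht, ?_⟩
    intro he
    apply hta
    have he : w * t * w = w * a * w := he
    exact mul_left_cancel (mul_right_cancel he)
  simpa [h.inv] using this

theorem conj_longest (h : IsL cs J w) {a u u' : W} (ha : IsL cs (J \ {a}) u)
    (hb : IsL cs (J \ {w * a * w}) u') : w * u * w = u' := by
  apply hb.uniq (h.conj_cl ha.mem)
  have hsub : ∀ b : W, Subgroup.closure (J \ {b}) ≤ Subgroup.closure J :=
    fun b => Subgroup.closure_mono Set.sdiff_subset
  rw [h.conj_len (hsub _ ha.mem), ← h.conj_len (hsub _ hb.mem)]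
  apply ha.max
  have := h.conj_cl hb.mem
  rwa [h.conj_conj] at this

end IsL

/-- One greedy step. -/
theorem step {J : Set W} {a w u u' z c : W} (haJ : a ∈ J) (h : IsL cs J w)
    (hu : IsL cs (J \ {a}) u) (hu' : IsL cs (J \ {w * a * w}) u')
    (hc : u * z = z * c) (hcl : cs.length c = cs.length u)
    (hadd : cs.length (u * z) = cs.length u + cs.length z)
    (hd : cs.length (a * z) < cs.length z) :
    ∃ y, z = (u * w) * y ∧ cs.length z = cs.length (u * w) + cs.length y ∧
      u' * y = y * c ∧ cs.length c = cs.length u' ∧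
      cs.length (u' * y) = cs.length u' + cs.length y ∧
      (∀ t ∈ J, cs.length y < cs.length (t * y)) := by
  have hsub : ∀ b : W, Subgroup.closure (J \ {b}) ≤ Subgroup.closure J :=
    fun b => Subgroup.closure_mono Set.sdiff_subset
  have hcj := h.conj_longest hu hu'
  have hlu : cs.length u' = cs.length u := by rw [← hcj, h.conj_len (hsub _ hu.mem)]
  have hdes : ∀ t ∈ J, cs.length (t * (u * z)) < cs.length (u * z) := by
    intro t ht
    by_cases hta : t = a
    · subst hta
      rw [hc, ← mul_assoc]
      have := cs.length_mul_le (t * z) c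
      rw [← hc]
      omega
    · have h1 := hu.lt (t := t) ⟨ht, hta⟩
      have := cs.length_mul_le (t * u) z
      rw [← mul_assoc]
      omega
  have hall := fun v (hv : v ∈ Subgroup.closure J) => desc h.sub hdes hv
  have hw := hall w h.mem
  rw [h.inv] at hw
  have huw := h.L1' (hsub _ hu.mem)
  refine ⟨w * (u * z), ?_, ?_, ?_, ?_, ?_, ?_⟩
  · have := h.mul_self
    have h2 := hu.mul_self
    calc z = u * u * z := by rw [h2, one_mul]
      _ = u * (w * w) * (u * z) := by rw [this]; group
      _ = _ := by group
  · omega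
  · have := h.mul_self
    rw [← hcj]
    calc _ = w * u * (w * w) * (u * z) := by group
      _ = w * u * (z * c) := by rw [this, hc]; group
      _ = _ := by group
  · omega
  · have h1 := hall (w * u') (mul_mem h.mem (hsub _ hu'.mem))
    rw [mul_inv_rev, h.inv, hu'.inv, mul_assoc] at h1
    have h2 : cs.length (w * u') + cs.length u' = cs.length w := by
      have := h.L1' (hsub _ hu'.mem)
      rw [← length_inv, mul_inv_rev, h.inv, hu'.inv] at this
      exact this
    omega
  · intro t ht
    have htc := Subgroup.subset_closure (k := J) ht
    have h1 := hall (w * t⁻¹) (mul_mem h.mem (inv_mem htc))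
    rw [mul_inv_rev, inv_inv, h.inv, mul_assoc] at h1
    have h2 := h.L1 (inv_mem htc)
    have h3 := h.lt ht
    have h4 : cs.length (w * t⁻¹) = cs.length (t * w) := by
      rw [← length_inv, mul_inv_rev, h.inv, inv_inv]
    omega

/-- The greedy decomposition. -/
theorem greedy (S : Set W) (hS : S = Set.range cs.simple) (wl : Set W → W)
    (hL : ∀ J ⊆ S, IsL cs J (wl J)) (c : W) (N : ℕ) :
    ∀ (s : ℕ → W) (_ : ∀ n, s n ∈ S) (_ : s 0 ≠ s 1)
    (_ : ∀ n : ℕ, s (n + 2) = wl (S \ {s (n + 1)}) * s n * wl (S \ {s (n + 1)}))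
    (z : W) (_ : cs.length z ≤ N)
    (_ : wl (S \ {s 0, s 1}) * z = z * c)
    (_ : cs.length c = cs.length (wl (S \ {s 0, s 1})))
    (_ : cs.length (wl (S \ {s 0, s 1}) * z) = cs.length (wl (S \ {s 0, s 1})) + cs.length z)
    (_ : z ≠ 1 → cs.length (s 0 * z) < cs.length z),
    ∃ m : ℕ, z = ((List.range m).map
          (fun j => wl (S \ {s j, s (j + 1)}) * wl (S \ {s (j + 1)}))).prod ∧
      cs.length z = ∑ j ∈ Finset.range m,
          cs.length (wl (S \ {s j, s (j + 1)}) * wl (S \ {s (j + 1)})) := by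
  induction N with
  | zero =>
    intro s _ _ _ z hz _ _ _ _
    have : cs.length z = 0 := by omega
    exact ⟨0, by simpa using this, by simpa using this⟩
  | succ N ih =>
    intro s hmem h01 hrec z hz h1 h2 h3 h4
    by_cases hz1 : z = 1
    · exact ⟨0, by simpa using hz1, by simp [hz1]⟩
    have h4 := h4 hz1
    have h0J : s 0 ∈ S \ {s 1} := ⟨hmem 0, h01⟩
    have hset : ∀ a b : W, S \ {a, b} = (S \ {b}) \ {a} := by
      intro a b; ext x; simp only [Set.mem_sdiff, Set.mem_insert_iff, Set.mem_singleton_iff]; tauto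
    have hset' : ∀ a b : W, S \ {b, a} = (S \ {b}) \ {a} := by
      intro a b; ext x; simp only [Set.mem_sdiff, Set.mem_insert_iff, Set.mem_singleton_iff]; tauto
    have hJ := hL (S \ {s 1}) Set.sdiff_subset
    have hu := hL (S \ {s 0, s 1}) Set.sdiff_subset
    have hu' := hL (S \ {s 1, s 2}) Set.sdiff_subset
    have hr0 : s 2 = _ := hrec 0
    have h12 : s 2 ∈ S \ {s 1} := by rw [hr0]; exact hJ.conj_mem h0J
    obtain ⟨y, g1, g2, g3, g4, g5, g6⟩ := step (a := s 0) (w := wl (S \ {s 1}))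
      (u := wl (S \ {s 0, s 1})) (u' := wl (S \ {s 1, s 2})) h0J hJ
      (by rw [← hset]; exact hu) (by rw [← hr0, ← hset']; exact hu') h1 h2 h3 h4
    have hpos : cs.length (wl (S \ {s 0, s 1}) * wl (S \ {s 1})) ≠ 0 := by
      intro h0
      rw [length_eq_zero_iff, mul_eq_one_iff_inv_eq, hu.inv] at h0
      have := hJ.lt h0J
      rw [← h0] at this
      have h5 := par_lt hu.sub hu.mem (t := s 0) (hS ▸ hmem 0) (by simp)
      omega
    obtain ⟨m, e1, e2⟩ := ih (fun n => s (n + 1)) (fun n => hmem _) (fun h => h12.2 h.symm)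
      (fun n => hrec (n + 1)) y (by omega) g3 g4 g5 (by
        intro hy
        obtain ⟨i, hi⟩ := cs.exists_leftDescent_of_ne_one hy
        by_cases h : cs.simple i = s 1
        · exact h ▸ hi
        · have := g6 (cs.simple i) ⟨hS ▸ Set.mem_range_self i, h⟩
          have : cs.length (cs.simple i * y) < cs.length y := hi
          omega)
    refine ⟨m + 1, ?_, ?_⟩
    · rw [List.range_succ_eq_map, List.map_cons, List.prod_cons, List.map_map]
      rw [g1]
      nth_rw 1 [e1]
      rfl
    · rw [Finset.sum_range_succ', g2, e2, add_comm]

end Luo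

theorem stmt_0 {B W : Type*} [Group W] [Finite W] {M : CoxeterMatrix B}
    (cs : CoxeterSystem M W)
    -- crystallographic condition: (W,S) is the Weyl group of a reduced root system
    (hcrys : ∀ i j : B, i ≠ j → M.M i j ∈ ({2, 3, 4, 6} : Set ℕ))
    (S : Set W) (hS : S = Set.range cs.simple)
    -- longest elements of the standard parabolic subgroups
    (wl : Set W → W)
    (hwl : ∀ J ⊆ S, wl J ∈ Subgroup.closure J ∧
      ∀ u ∈ Subgroup.closure J, cs.length u ≤ cs.length (wl J))
    -- the Luo sequence: s₀ ≠ s₁ in S, s_{n+1} = w_{S∖{s_n}} s_{n−1} w_{S∖{s_n}}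
    (s : ℕ → W) (hmem : ∀ n, s n ∈ S) (h01 : s 0 ≠ s 1)
    (hrec : ∀ n : ℕ, s (n + 2) = wl (S \ {s (n + 1)}) * s n * wl (S \ {s (n + 1)})) :
    ∃! m : ℕ, 1 ≤ m ∧
      wl (S \ {s 0, s 1}) * wl S =
        ((List.range m).map
          (fun j => wl (S \ {s j, s (j + 1)}) * wl (S \ {s (j + 1)}))).prod ∧
      cs.length (wl (S \ {s 0, s 1}) * wl S) =
        ∑ j ∈ Finset.range m,
          cs.length (wl (S \ {s j, s (j + 1)}) * wl (S \ {s (j + 1)})) := by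
  
  have hL : ∀ J ⊆ S, Luo.IsL cs J (wl J) := fun J hJ => ⟨hS ▸ hJ, (hwl J hJ).1, (hwl J hJ).2⟩
  have hne : ∀ n, s n ≠ s (n + 1) := by
    intro n
    induction n with
    | zero => exact h01
    | succ n ih =>
      have h1 := (hL (S \ {s (n + 1)}) Set.sdiff_subset).conj_mem (t := s n) ⟨hmem n, ih⟩
      rw [← hrec n] at h1
      exact fun h => h1.2 h.symm
  have hpos : ∀ n, 0 < cs.length (wl (S \ {s n, s (n + 1)}) * wl (S \ {s (n + 1)})) := by
    intro n
    rw [Nat.pos_iff_ne_zero]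
    intro h0
    have hu := hL (S \ {s n, s (n + 1)}) Set.sdiff_subset
    rw [CoxeterSystem.length_eq_zero_iff, mul_eq_one_iff_inv_eq, hu.inv] at h0
    have := (hL (S \ {s (n + 1)}) Set.sdiff_subset).lt (t := s n) ⟨hmem n, hne n⟩
    rw [← h0] at this
    have h5 := Luo.par_lt hu.sub hu.mem (t := s n) (hS ▸ hmem n) (by simp)
    omega
  have hw := hL S subset_rfl
  have hu := hL (S \ {s 0, s 1}) Set.sdiff_subset
  have huS : wl (S \ {s 0, s 1}) ∈ Subgroup.closure S :=
    Subgroup.closure_mono Set.sdiff_subset hu.mem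
  have hl1 := hw.L1' huS
  have e1 : wl (S \ {s 0, s 1}) * (wl (S \ {s 0, s 1}) * wl S) = wl S := by
    rw [← mul_assoc, hu.mul_self, one_mul]
  have hd : cs.length (s 0 * (wl (S \ {s 0, s 1}) * wl S)) <
      cs.length (wl (S \ {s 0, s 1}) * wl S) := by
    have h5 := Luo.par_lt hu.sub hu.mem (t := s 0) (hS ▸ hmem 0) (by simp)
    have h6 := hw.L1' (mul_mem (Subgroup.subset_closure (hmem 0)) huS)
    rw [mul_assoc] at h6
    omega
  obtain ⟨m, g1, g2⟩ := Luo.greedy S hS wl hL (wl S * wl (S \ {s 0, s 1}) * wl S) _ s hmem h01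
    hrec (wl (S \ {s 0, s 1}) * wl S) le_rfl
    (by
      rw [e1]
      calc wl S = wl (S \ {s 0, s 1}) * wl (S \ {s 0, s 1}) * wl S := by
            rw [hu.mul_self, one_mul]
        _ = wl (S \ {s 0, s 1}) * (wl S * wl S) * wl (S \ {s 0, s 1}) * wl S := by
            rw [hw.mul_self, mul_one]
        _ = _ := by simp only [mul_assoc])
    (hw.conj_len huS) (by rw [e1]; omega) (fun _ => hd)
  refine ⟨m, ⟨?_, g1, g2⟩, ?_⟩
  · by_contra hm
    have hm : m = 0 := by omega
    subst hm
    simp only [Finset.range_zero, Finset.sum_empty] at g2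
    omega
  · rintro m' ⟨_, _, h3⟩
    have hmono : StrictMono (fun m => ∑ j ∈ Finset.range m,
        cs.length (wl (S \ {s j, s (j + 1)}) * wl (S \ {s (j + 1)}))) := by
      apply strictMono_nat_of_lt_succ
      intro n
      have := hpos n
      simp only [Finset.sum_range_succ]
      omega
    exact hmono.injective (h3.symm.trans g2)
end

section
/- Let {s_i}_{i∈ℤ} be the bi-infinite Luo sequence generated by distinct s₀, s₁ ∈ S, and set w_i = w_{S∖{s_i}}, w'_i = w_{S∖{s_i,s_{i+1}}}. For each starting index k ≥ 0 let m_k ≥ 1 be the integer such that (w'_k w_{k+1})(w'_{k+1}w_{k+2})⋯(w'_{k+m_k−1}w_{k+m_k}) = w'_k w_S with Σ_{j=1}^{m_k} ℓ(w'_{k+j−1}w_{k+j}) = ℓ(w'_k w_S). Then all m_k are equal, i.e. m_k is independent of k. -/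
namespace LuoAux

variable {B W : Type*} [Group W] {M : CoxeterMatrix B} (cs : CoxeterSystem M W)

open Classical in
noncomputable def act (i : B) : Function.End (W × ZMod 2) :=
  fun p => (cs.simple i * p.1 * cs.simple i, p.2 + if p.1 = cs.simple i then 1 else 0)

theorem end_one {α : Type*} (a : α) : (1 : Function.End α) a = a := rfl

open Classical in
theorem act_pow (i j : B) (n : ℕ) (t : W) (e : ZMod 2) :
    ((act cs i * act cs j) ^ n : Function.End (W × ZMod 2)) (t, e) =
      ((cs.simple i * cs.simple j) ^ n * t * ((cs.simple i * cs.simple j) ^ n)⁻¹,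
        e + ∑ r ∈ Finset.range (2 * n),
          if t = cs.simple j * (cs.simple i * cs.simple j) ^ r then 1 else 0) := by
  induction n with
  | zero => simp [end_one]
  | succ n ih =>
    have hconj : ∀ n : ℕ, ((cs.simple i * cs.simple j) ^ n)⁻¹ * cs.simple j =
        cs.simple j * (cs.simple i * cs.simple j) ^ n := by
      intro n
      induction n with
      | zero => simp
      | succ n ih =>
        rw [pow_succ, mul_inv_rev, mul_assoc, ih, ← mul_assoc, ← pow_succ,
          pow_succ']
        simp [mul_assoc]
    rw [pow_succ']
    show (act cs i * act cs j) (((act cs i * act cs j) ^ n : Function.End (W × ZMod 2)) (t, e)) = _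
    rw [ih]
    show act cs i (act cs j _) = _
    have e1 : ((cs.simple i * cs.simple j) ^ n * t * ((cs.simple i * cs.simple j) ^ n)⁻¹ =
        cs.simple j) ↔ t = cs.simple j * (cs.simple i * cs.simple j) ^ (2 * n) := by
      rw [two_mul, pow_add, ← mul_assoc, ← hconj, mul_inv_eq_iff_eq_mul, ← eq_inv_mul_iff_mul_eq,
        mul_assoc]
    have e2 : (cs.simple j * ((cs.simple i * cs.simple j) ^ n * t *
        ((cs.simple i * cs.simple j) ^ n)⁻¹) * cs.simple j =
        cs.simple i) ↔ t = cs.simple j * (cs.simple i * cs.simple j) ^ (2 * n + 1) := by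
      have : (2 * n + 1) = n + (1 + n) := by ring
      rw [this, pow_add, ← mul_assoc (cs.simple j) ((cs.simple i * cs.simple j) ^ n)
        ((cs.simple i * cs.simple j) ^ (1 + n)), ← hconj, pow_add, pow_one]
      generalize (cs.simple i * cs.simple j) ^ n = q
      constructor
      · intro h
        rw [← h]; simp [mul_assoc]
      · intro h
        rw [h]; simp [mul_assoc]
    simp only [act]
    rw [show 2 * (n + 1) = 2 * n + 1 + 1 by ring, Finset.sum_range_succ, Finset.sum_range_succ]
    simp only [e1, e2]
    ext
    · simp [pow_succ', mul_assoc]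
    · simp [add_assoc]

theorem act_liftable : M.IsLiftable (act cs) := by
  classical
  intro i j
  funext ⟨t, e⟩
  rw [act_pow, cs.simple_mul_simple_pow, two_mul, Finset.sum_range_add]
  simp only [pow_add, cs.simple_mul_simple_pow, one_mul]
  have : ∀ x : ZMod 2, x + x = 0 := by decide
  rw [this]
  simp [end_one]

noncomputable def phi : W →* Function.End (W × ZMod 2) := cs.lift ⟨act cs, act_liftable cs⟩

theorem phi_simple (i : B) : phi cs (cs.simple i) = act cs i :=
  cs.lift_apply_simple (act_liftable cs) i

noncomputable def eta (w t : W) : ZMod 2 := (phi cs w (t, 0)).2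

theorem phi_apply (w t : W) (e : ZMod 2) :
    phi cs w (t, e) = (w * t * w⁻¹, e + eta cs w t) := by
  unfold eta
  induction w using cs.simple_induction_left generalizing t e with
  | one => simp [end_one]
  | mul_simple_left w i ih =>
    simp only [map_mul, phi_simple]
    show act cs i (phi cs w (t, e)) = (_, _ + (act cs i (phi cs w (t, 0))).2)
    rw [ih t e, ih t 0]
    simp [act, mul_assoc, add_assoc]

theorem eta_mul (u w t : W) : eta cs (u * w) t = eta cs w t + eta cs u (w * t * w⁻¹) := by
  conv_lhs => unfold eta
  rw [map_mul]
  show (phi cs u (phi cs w (t, 0))).2 = _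
  rw [phi_apply, phi_apply]
  simp

theorem eta_one (t : W) : eta cs 1 t = 0 := by simp [eta, end_one]

theorem eta_simple_self (i : B) : eta cs (cs.simple i) (cs.simple i) = 1 := by
  simp [eta, phi_simple, act]

theorem eta_refl {t : W} (ht : cs.IsReflection t) : eta cs t t = 1 := by
  obtain ⟨u, i, rfl⟩ := ht
  have h := eta_mul cs u u⁻¹ (u * cs.simple i * u⁻¹)
  rw [mul_inv_cancel, eta_one] at h
  rw [eta_mul, eta_mul]
  simp only [inv_inv, mul_assoc, inv_mul_cancel, inv_mul_cancel_left, mul_one] at h ⊢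
  simp only [cs.inv_simple,
    cs.simple_mul_simple_self, mul_one, eta_simple_self]
  rw [add_left_comm, ← h, add_zero]

theorem mem_ris (ω : List B) (t : W) (h : eta cs (cs.wordProd ω) t ≠ 0) :
    t ∈ cs.rightInvSeq ω := by
  induction ω with
  | nil => simp [eta_one] at h
  | cons i ω ih =>
    rw [cs.wordProd_cons, eta_mul] at h
    simp only [CoxeterSystem.rightInvSeq, List.mem_cons]
    by_cases h0 : eta cs (cs.wordProd ω) t = 0
    · left
      rw [h0, zero_add] at h
      simp only [eta, phi_simple, act] at h
      have h2 : cs.wordProd ω * t * (cs.wordProd ω)⁻¹ = cs.simple i := by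
        by_contra hne
        simp [hne] at h
      rw [← h2]; simp [mul_assoc]
    · right; exact ih h0

theorem eta_iff {t : W} (ht : cs.IsReflection t) (w : W) :
    eta cs w t = 1 ↔ cs.length (w * t) < cs.length w := by
  have key : ∀ w : W, eta cs w t ≠ 0 → cs.length (w * t) < cs.length w := by
    intro w h
    obtain ⟨ω, hω, rfl⟩ := cs.exists_isReduced w
    exact (cs.isRightInversion_of_mem_rightInvSeq hω (mem_ris cs ω t h)).2
  have z2 : ∀ x : ZMod 2, x ≠ 1 → x = 0 := by decide
  constructor
  · intro h; exact key w (by rw [h]; decide)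
  · intro h
    by_contra hne
    have h0 := z2 _ hne
    have := key (w * t) (by
      rw [eta_mul, eta_refl cs ht, mul_inv_cancel_right, h0]; decide)
    rw [mul_assoc, ht.mul_self, mul_one] at this
    omega

theorem exists_jword {J : Set W} (hJ : J ⊆ Set.range cs.simple) {u : W}
    (hu : u ∈ Subgroup.closure J) :
    ∃ ω : List B, (∀ i ∈ ω, cs.simple i ∈ J) ∧ cs.IsReduced ω ∧ u = cs.wordProd ω := by
  have step : ∀ x : W, ∀ y ∈ J, (∃ ω : List B, (∀ i ∈ ω, cs.simple i ∈ J) ∧ cs.IsReduced ω ∧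
      x = cs.wordProd ω) → (∃ ω : List B, (∀ i ∈ ω, cs.simple i ∈ J) ∧ cs.IsReduced ω ∧
      x * y = cs.wordProd ω) := by
    rintro x y hy ⟨ω, h1, h2, rfl⟩
    obtain ⟨i, rfl⟩ := hJ hy
    by_cases hd : cs.length (cs.wordProd ω * cs.simple i) < cs.length (cs.wordProd ω)
    · have he := (eta_iff cs (cs.isReflection_simple i) _).2 hd
      have hm := mem_ris cs ω _ (by rw [he]; decide)
      obtain ⟨j, hj, hj2⟩ := List.getElem_of_mem hm
      have h3 := cs.wordProd_mul_getD_rightInvSeq ω j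
      rw [List.getD_eq_getElem _ _ hj, hj2] at h3
      rw [h3] at hd
      rw [cs.length_rightInvSeq] at hj
      refine ⟨ω.eraseIdx j, fun i hi => h1 i (List.mem_of_mem_eraseIdx hi), ?_, h3⟩
      have h4 := cs.length_mul_simple (cs.wordProd ω) i
      rw [h3] at h4
      have h5 := List.length_eraseIdx_of_lt hj
      have h6 := h2.eq
      unfold CoxeterSystem.IsReduced
      omega
    · refine ⟨ω ++ [i], ?_, ?_, by simp [cs.wordProd_append]⟩
      · intro k hk
        simp only [List.mem_append, List.mem_singleton] at hk
        rcases hk with hk | rfl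
        · exact h1 k hk
        · exact hy
      · unfold CoxeterSystem.IsReduced
        have h4 := cs.length_mul_simple (cs.wordProd ω) i
        have h6 := h2.eq
        simp only [cs.wordProd_append, cs.wordProd_singleton, List.length_append,
          List.length_singleton]
        omega
  induction hu using Subgroup.closure_induction_right with
  | one => exact ⟨[], by simp, by simp [CoxeterSystem.IsReduced], by simp⟩
  | mul_right x hx y hy ih => exact step x y hy ih
  | mul_inv_cancel x hx y hy ih =>
    obtain ⟨i, rfl⟩ := hJ hy
    rw [cs.inv_simple]
    exact step x _ hy ih

theorem mem_of_simple {J : Set W} (hJ : J ⊆ Set.range cs.simple) {a : W}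
    (ha : cs.length a = 1) (hu : a ∈ Subgroup.closure J) : a ∈ J := by
  obtain ⟨ω, h1, h2, rfl⟩ := exists_jword cs hJ hu
  rw [h2.eq, List.length_eq_one_iff] at ha
  obtain ⟨i, rfl⟩ := ha
  simpa using h1 i (by simp)

def IsMax (J : Set W) (x : W) : Prop :=
  x ∈ Subgroup.closure J ∧ ∀ u ∈ Subgroup.closure J, cs.length u ≤ cs.length x

variable {cs} {J K K' : Set W} {x y z u a : W}

theorem IsMax.mul (hJ : J ⊆ Set.range cs.simple) (hx : IsMax cs J x)
    (hu : u ∈ Subgroup.closure J) : cs.length (x * u) + cs.length u = cs.length x := by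
  have z2 : ∀ x : ZMod 2, x ≠ 1 → x = 0 := by decide
  have key : ∀ u ∈ Subgroup.closure J, ∀ i : B, cs.simple i ∈ J →
      ¬ cs.length (u * cs.simple i) < cs.length u →
      cs.length (x * u * cs.simple i) < cs.length (x * u) := by
    intro u hu i hi h
    have hs := cs.isReflection_simple i
    have ht := hs.conj u
    have hsc := Subgroup.subset_closure hi
    have h1 : eta cs x (u * cs.simple i * u⁻¹) = 1 := by
      rw [eta_iff cs ht]
      have := hx.2 (x * (u * cs.simple i * u⁻¹))
        (mul_mem hx.1 (mul_mem (mul_mem hu hsc) (inv_mem hu)))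
      have h2 := ht.length_mul_left_ne x
      omega
    have h2 : eta cs u (cs.simple i) = 0 := by
      rw [← eta_iff cs hs] at h
      exact z2 _ h
    rw [← eta_iff cs hs, eta_mul, h1, h2, zero_add]
  have step : ∀ u ∈ Subgroup.closure J, ∀ y ∈ J,
      cs.length (x * u) + cs.length u = cs.length x →
      cs.length (x * (u * y)) + cs.length (u * y) = cs.length x := by
    intro u hu y hy h
    obtain ⟨i, rfl⟩ := hJ hy
    have h1 := cs.length_mul_simple (x * u) i
    have h2 := cs.length_mul_simple u i
    rw [← mul_assoc]
    by_cases hd : cs.length (u * cs.simple i) < cs.length u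
    · have := key (u * cs.simple i) (mul_mem hu (Subgroup.subset_closure hy)) i hy
        (by rw [cs.simple_mul_simple_cancel_right]; omega)
      rw [mul_assoc, cs.simple_mul_simple_cancel_right, ← mul_assoc] at this
      omega
    · have := key u hu i hy hd
      omega
  induction hu using Subgroup.closure_induction_right with
  | one => simp
  | mul_right u hu y hy ih => exact step u hu y hy ih
  | mul_inv_cancel u hu y hy ih =>
    obtain ⟨i, rfl⟩ := hJ hy
    rw [cs.inv_simple]
    exact step u hu _ hy ih

theorem IsMax.sq (hJ : J ⊆ Set.range cs.simple) (hx : IsMax cs J x) : x * x = 1 := by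
  have := hx.mul hJ hx.1
  exact cs.length_eq_zero_iff.1 (by omega)

theorem IsMax.inv (hJ : J ⊆ Set.range cs.simple) (hx : IsMax cs J x) : x⁻¹ = x :=
  inv_eq_of_mul_eq_one_left (hx.sq hJ)

theorem IsMax.mul' (hJ : J ⊆ Set.range cs.simple) (hx : IsMax cs J x)
    (hu : u ∈ Subgroup.closure J) : cs.length (u * x) + cs.length u = cs.length x := by
  have := hx.mul hJ (inv_mem hu)
  rwa [cs.length_inv, ← cs.length_inv (x * u⁻¹), mul_inv_rev, inv_inv, hx.inv hJ] at this

theorem IsMax.uniq (hJ : J ⊆ Set.range cs.simple) (hx : IsMax cs J x) (hy : IsMax cs J y) :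
    x = y := by
  have h := hx.mul hJ hy.1
  have h1 := hx.2 _ hy.1
  have h2 := hy.2 _ hx.1
  have h3 : x * y = 1 := cs.length_eq_zero_iff.1 (by omega)
  rw [← hy.inv hJ]
  exact eq_inv_of_mul_eq_one_left h3

theorem IsMax.conj_length (hJ : J ⊆ Set.range cs.simple) (hx : IsMax cs J x)
    (hu : u ∈ Subgroup.closure J) : cs.length (x * u * x) = cs.length u := by
  have h1 := hx.mul hJ (mul_mem hu hx.1)
  have h2 := hx.mul' hJ hu
  rw [mul_assoc]
  omega

theorem len_one (hJ : J ⊆ Set.range cs.simple) (ha : a ∈ J) : cs.length a = 1 := by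
  obtain ⟨i, rfl⟩ := hJ ha
  simp

theorem IsMax.conj_mem (hJ : J ⊆ Set.range cs.simple) (hx : IsMax cs J x)
    (ha : a ∈ J) : x * a * x ∈ J := by
  have hc := Subgroup.subset_closure ha
  apply mem_of_simple cs hJ
  · rw [hx.conj_length hJ hc, len_one hJ ha]
  · exact mul_mem (mul_mem hx.1 hc) hx.1

theorem conj_closure (hsq : x * x = 1) (h : ∀ a ∈ K, x * a * x ∈ K')
    (hu : u ∈ Subgroup.closure K) : x * u * x ∈ Subgroup.closure K' := by
  have hi : x⁻¹ = x := inv_eq_of_mul_eq_one_left hsq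
  induction hu using Subgroup.closure_induction with
  | mem a ha => exact Subgroup.subset_closure (h a ha)
  | one => simp [hsq]
  | mul a b _ _ iha ihb =>
    have : x * (a * b) * x = (x * a * x) * (x * b * x) := by
      calc x * (a * b) * x = x * a * 1 * b * x := by simp [mul_assoc]
        _ = _ := by rw [← hsq]; simp only [mul_assoc]
    rw [this]; exact mul_mem iha ihb
  | inv a _ iha =>
    have : x * a⁻¹ * x = (x * a * x)⁻¹ := by simp [hi, mul_assoc]
    rw [this]; exact inv_mem iha

theorem conj_conj (hsq : x * x = 1) (a : W) : x * (x * a * x) * x = a := by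
  calc x * (x * a * x) * x = (x * x) * a * (x * x) := by simp only [mul_assoc]
    _ = a := by simp [hsq]

theorem IsMax.conj_max (hJ : J ⊆ Set.range cs.simple) (hx : IsMax cs J x) (hK : K ⊆ J)
    (hK' : K' ⊆ J) (h : ∀ a ∈ K, x * a * x ∈ K') (h' : ∀ a ∈ K', x * a * x ∈ K)
    (hy : IsMax cs K y) (hz : IsMax cs K' z) : x * y * x = z := by
  have hsq := hx.sq hJ
  refine IsMax.uniq (hK'.trans hJ) ⟨conj_closure hsq h hy.1, fun u hu => ?_⟩ hz
  rw [hx.conj_length hJ (Subgroup.closure_mono hK hy.1),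
    ← hx.conj_length hJ (Subgroup.closure_mono hK' hu)]
  exact hy.2 _ (conj_closure hsq h' hu)

theorem IsMax.descent (hJ : J ⊆ Set.range cs.simple) (hx : IsMax cs J x)
    (ha : a ∈ Set.range cs.simple) : cs.length (x * a) < cs.length x ↔ a ∈ J := by
  constructor
  · intro h
    obtain ⟨ω, h1, h2, rfl⟩ := exists_jword cs hJ hx.1
    obtain ⟨i, rfl⟩ := ha
    have he := (eta_iff cs (cs.isReflection_simple i) _).2 h
    have hm := mem_ris cs ω _ (by rw [he]; decide)
    obtain ⟨j, hj, hj2⟩ := List.getElem_of_mem hm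
    have h3 := cs.wordProd_mul_getD_rightInvSeq ω j
    rw [List.getD_eq_getElem _ _ hj, hj2] at h3
    apply mem_of_simple cs hJ (by simp)
    have h4 : cs.wordProd (ω.eraseIdx j) ∈ Subgroup.closure J := by
      unfold CoxeterSystem.wordProd
      apply Subgroup.list_prod_mem
      intro b hb
      obtain ⟨k, hk, rfl⟩ := List.mem_map.1 hb
      exact Subgroup.subset_closure (h1 k (List.mem_of_mem_eraseIdx hk))
    rw [← h3] at h4
    exact (Subgroup.mul_mem_cancel_left _ hx.1).1 h4
  · intro h
    have h1 := hx.mul hJ (Subgroup.subset_closure h)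
    rw [len_one hJ h] at h1
    omega

section main

variable (S : Set W) (wl : Set W → W) (t : ℕ → W)

def fac (j : ℕ) : W := wl (S \ {t j, t (j + 1)}) * wl (S \ {t (j + 1)})

def pr (a n : ℕ) : W := ((List.range n).map (fun j => fac S wl t (a + j))).prod

theorem pr_succ (a n : ℕ) : pr S wl t a (n + 1) = pr S wl t a n * fac S wl t (a + n) := by
  simp [pr, List.range_succ]

theorem pr_add (a n p : ℕ) : pr S wl t a (n + p) = pr S wl t a n * pr S wl t (a + n) p := by
  induction p with
  | zero => simp [pr]
  | succ p ih => rw [← add_assoc, pr_succ, ih, pr_succ, mul_assoc, add_assoc]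

theorem pr_one (a : ℕ) : pr S wl t a 1 = fac S wl t a := by simp [pr]

theorem pr_length (cs : CoxeterSystem M W) (a n : ℕ) :
    cs.length (pr S wl t a n) ≤ ∑ j ∈ Finset.range n, cs.length (fac S wl t (a + j)) := by
  induction n with
  | zero => simp [pr]
  | succ n ih =>
    rw [pr_succ, Finset.sum_range_succ]
    exact (cs.length_mul_le _ _).trans (by omega)

variable {S wl t}

theorem main_step (hS : S = Set.range cs.simple) (hwl : ∀ J ⊆ S, IsMax cs J (wl J))
    (hmem : ∀ n, t n ∈ S) (h01 : t 0 ≠ t 1)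
    (hrec : ∀ n, t (n + 2) = wl (S \ {t (n + 1)}) * t n * wl (S \ {t (n + 1)}))
    (mk : ℕ → ℕ)
    (hmk : ∀ k : ℕ, 1 ≤ mk k ∧
      wl (S \ {t k, t (k + 1)}) * wl S = pr S wl t k (mk k) ∧
      cs.length (wl (S \ {t k, t (k + 1)}) * wl S) =
        ∑ j ∈ Finset.range (mk k), cs.length (fac S wl t (k + j))) (k : ℕ) :
    mk (k + 1) = mk k := by
  have sub : ∀ J : Set W, S \ J ⊆ S := fun J => Set.sdiff_subset
  have subr : ∀ {J : Set W}, J ⊆ S → J ⊆ Set.range cs.simple := fun h => hS ▸ h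
  have SR : S ⊆ Set.range cs.simple := hS.le
  -- distinctness
  have hne : ∀ n, t n ≠ t (n + 1) := by
    intro n
    induction n with
    | zero => exact h01
    | succ n ih =>
      have h1 : t n ∈ S \ {t (n + 1)} := ⟨hmem n, by simpa using ih⟩
      have h2 := (hwl _ (sub {t (n + 1)})).conj_mem (subr (sub _)) h1
      rw [← hrec] at h2
      intro h
      exact h2.2 (by simp [h])
  have J1 : ∀ n, S \ {t n, t (n + 1)} ⊆ S \ {t (n + 1)} := by
    intro n; apply Set.sdiff_subset_sdiff_right; simp
  have J2 : ∀ n, S \ {t n, t (n + 1)} ⊆ S \ {t n} := by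
    intro n; apply Set.sdiff_subset_sdiff_right; simp
  -- involutions
  have wsq : ∀ {J : Set W}, J ⊆ S → wl J * wl J = 1 := fun h => (hwl _ h).sq (subr h)
  -- conjugation by w (n+1)
  have cS : ∀ n, ∀ a ∈ S \ {t n, t (n + 1)},
      wl (S \ {t (n + 1)}) * a * wl (S \ {t (n + 1)}) ∈ S \ {t (n + 1), t (n + 2)} := by
    intro n a ha
    have h2 := (hwl _ (sub {t (n + 1)})).conj_mem (subr (sub _)) (J1 n ha)
    refine ⟨h2.1, ?_⟩
    rintro (h | h)
    · exact h2.2 h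
    · have h : _ = t (n + 2) := h
      rw [hrec] at h
      have : a = t n := mul_left_cancel (mul_right_cancel h)
      exact ha.2 (by simp [this])
  have cS' : ∀ n, ∀ a ∈ S \ {t (n + 1), t (n + 2)},
      wl (S \ {t (n + 1)}) * a * wl (S \ {t (n + 1)}) ∈ S \ {t n, t (n + 1)} := by
    intro n a ha
    have h2 := (hwl _ (sub {t (n + 1)})).conj_mem (subr (sub _)) (J2 (n + 1) ha)
    refine ⟨h2.1, ?_⟩
    rintro (h | h)
    · have : a = t (n + 2) := by
        rw [hrec, ← h, conj_conj (wsq (sub _))]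
      exact ha.2 (by simp [this])
    · exact h2.2 h
  have cw : ∀ n, wl (S \ {t (n + 1)}) * wl (S \ {t (n + 1), t (n + 2)}) * wl (S \ {t (n + 1)}) =
      wl (S \ {t n, t (n + 1)}) := fun n =>
    (hwl _ (sub _)).conj_max (subr (sub _)) (J2 (n + 1)) (J1 n) (cS' n) (cS n)
      (hwl _ (sub _)) (hwl _ (sub _))
  have fac' : ∀ n, fac S wl t n = wl (S \ {t (n + 1)}) * wl (S \ {t (n + 1), t (n + 2)}) := by
    intro n
    unfold fac
    rw [← cw n, mul_assoc, wsq (sub _), mul_one]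
  -- last descent of fac n is t (n+2)
  have facne : ∀ n, fac S wl t n ≠ 1 := by
    intro n h
    unfold fac at h
    have h1 := (hwl _ (sub {t (n + 1)})).descent (subr (sub _)) (SR (hmem n))
    have h2 := (hwl _ (sub {t n, t (n + 1)})).descent (subr (sub _)) (SR (hmem n))
    have h3 : wl (S \ {t n, t (n + 1)}) = wl (S \ {t (n + 1)}) := by
      have := eq_inv_of_mul_eq_one_left h
      rwa [(hwl _ (sub _)).inv (subr (sub _))] at this
    rw [h3, h1] at h2
    have : t n ∈ S \ {t (n + 1)} := ⟨hmem n, by simpa using hne n⟩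
    exact (h2.1 this).2 (by simp)
  have facdesc : ∀ n, cs.length (fac S wl t n * t (n + 2)) < cs.length (fac S wl t n) := by
    intro n
    -- fac n = w' n * w (n+1) ; length additive
    have hx := hwl _ (sub {t (n + 1)})
    have hy := hwl _ (sub {t n, t (n + 1)})
    have hyc := Subgroup.closure_mono (J1 n) hy.1
    have htc : t n ∈ Subgroup.closure (S \ {t (n + 1)}) :=
      Subgroup.subset_closure ⟨hmem n, by simpa using hne n⟩
    have h1 := hx.mul' (subr (sub _)) hyc
    have h2 := hx.mul' (subr (sub _)) (mul_mem hyc htc)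
    have h3 := hy.descent (subr (sub _)) (SR (hmem n))
    have h4 : t n ∉ S \ {t n, t (n + 1)} := by simp
    have h5 : wl (S \ {t n, t (n + 1)}) * t n * wl (S \ {t (n + 1)}) =
        fac S wl t n * t (n + 2) := by
      unfold fac
      rw [hrec]
      simp only [mul_assoc]
      rw [← mul_assoc (wl (S \ {t (n + 1)})) (wl (S \ {t (n + 1)})), wsq (sub _), one_mul]
    obtain ⟨i, hi⟩ := SR (hmem n)
    have h6 := cs.length_mul_simple_ne (wl (S \ {t n, t (n + 1)})) i
    rw [hi] at h6
    rw [h5] at h2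
    rw [← h3] at h4
    unfold fac at *
    omega
  -- conjugation along the product
  have prc : ∀ a n, ∀ x, x ∈ S \ {t a, t (a + 1)} ↔
      (pr S wl t a n)⁻¹ * x * pr S wl t a n ∈ S \ {t (a + n), t (a + n + 1)} := by
    intro a n
    induction n with
    | zero => intro x; simp [pr]
    | succ n ih =>
      intro x
      rw [ih x, pr_succ]
      generalize (pr S wl t a n) = P
      have hy := hwl _ (sub {t (a + n), t (a + n + 1)})
      have hx := hwl _ (sub {t (a + n + 1)})
      have e1 : (P * fac S wl t (a + n))⁻¹ * x * (P * fac S wl t (a + n)) =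
          wl (S \ {t (a + n + 1)}) * (wl (S \ {t (a + n), t (a + n + 1)}) * (P⁻¹ * x * P) *
            wl (S \ {t (a + n), t (a + n + 1)})) * wl (S \ {t (a + n + 1)}) := by
        unfold fac
        simp only [mul_inv_rev, hx.inv (subr (sub _)), hy.inv (subr (sub _)), mul_assoc]
      rw [e1]
      generalize P⁻¹ * x * P = y
      constructor
      · intro h
        exact cS (a + n) _ (hy.conj_mem (subr (sub _)) h)
      · intro h
        have := cS' (a + n) _ h
        rw [conj_conj (wsq (sub _))] at this
        have := hy.conj_mem (subr (sub _)) this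
        rwa [conj_conj (wsq (sub _))] at this
  have hSS : IsMax cs S (wl S) := hwl S le_rfl
  have wSsq : wl S * wl S = 1 := wsq le_rfl
  obtain ⟨hm1, hP, hL⟩ := hmk k
  obtain ⟨hm1', hP', hL'⟩ := hmk (k + 1)
  generalize mk (k + 1) = m' at *
  obtain ⟨m, hm⟩ : ∃ m, mk k = m + 1 := ⟨mk k - 1, by omega⟩
  rw [hm] at hP hL ⊢
  -- tail product
  have hhead : pr S wl t k (m + 1) = fac S wl t k * pr S wl t (k + 1) m := by
    rw [add_comm m 1, pr_add, pr_one]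
  have htail : pr S wl t (k + 1) m = wl (S \ {t (k + 1)}) * wl S := by
    rw [hhead] at hP
    unfold fac at hP
    rw [mul_assoc] at hP
    have := mul_left_cancel hP
    rw [this, ← mul_assoc, wsq (sub _), one_mul]
  obtain ⟨p, rfl⟩ : ∃ p, m = p + 1 := by
    rcases m with _ | p
    · exfalso
      have h1 : wl (S \ {t (k + 1)}) = wl S := by
        have h : 1 = wl (S \ {t (k + 1)}) * wl S := by simpa [pr] using htail
        have := eq_inv_of_mul_eq_one_left h.symm
        rwa [hSS.inv SR] at this
      have h2 := (hwl _ (sub {t (k + 1)})).descent (subr (sub _)) (SR (hmem (k + 1)))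
      have h3 := hSS.descent SR (SR (hmem (k + 1)))
      rw [h1, h3] at h2
      exact (h2.1 (hmem _)).2 rfl
    · exact ⟨p, rfl⟩
  -- lengths
  have hsum : ∀ n, ∑ j ∈ Finset.range (n + 1), cs.length (fac S wl t (k + j)) =
      cs.length (fac S wl t k) + ∑ j ∈ Finset.range n, cs.length (fac S wl t (k + 1 + j)) := by
    intro n
    rw [Finset.sum_range_succ', add_comm]
    simp only [add_zero]
    congr 1
    exact Finset.sum_congr rfl (fun j _ => by rw [show k + (j + 1) = k + 1 + j by ring])
  have hq : k + 1 + p + 2 = k + (p + 1 + 1) + 1 := by ring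
  -- sigma (t (k+m+1)) = t (k+1)
  have hs1 : wl S * t (k + (p + 1 + 1) + 1) * wl S = t (k + 1) := by
    have d := facdesc (k + 1 + p)
    rw [hq] at d
    have e1 := hsum (p + 1)
    rw [← hL, hP, hhead, Finset.sum_range_succ] at e1
    have e2 := cs.length_mul_le (fac S wl t k) (pr S wl t (k + 1) (p + 1))
    have e3 := pr_length S wl t cs (k + 1) p
    have e4 := cs.length_mul_le (pr S wl t (k + 1) p)
      (fac S wl t (k + 1 + p) * t (k + (p + 1 + 1) + 1))
    rw [← mul_assoc, ← pr_succ] at e4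
    have e5 : cs.length (pr S wl t (k + 1) (p + 1) * t (k + (p + 1 + 1) + 1)) <
        cs.length (pr S wl t (k + 1) (p + 1)) := by omega
    rw [htail] at e5
    have hc := hSS.conj_mem SR (hmem (k + (p + 1 + 1) + 1))
    have e6 : wl (S \ {t (k + 1)}) * wl S * t (k + (p + 1 + 1) + 1) =
        wl (S \ {t (k + 1)}) * (wl S * t (k + (p + 1 + 1) + 1) * wl S) * wl S := by
      simp only [mul_assoc, wSsq, mul_one]
    rw [e6] at e5
    generalize wl S * t (k + (p + 1 + 1) + 1) * wl S = b at *
    have hx := hwl _ (sub {t (k + 1)})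
    have hxc := Subgroup.closure_mono (sub _) hx.1
    have f1 := hSS.mul' SR hxc
    have f2 := hSS.mul' SR (mul_mem hxc (Subgroup.subset_closure hc))
    have f3 := hx.descent (subr (sub _)) (SR hc)
    by_contra hbne
    have := f3.2 ⟨hc, hbne⟩
    omega
  have hs0 : wl S * t (k + (p + 1 + 1)) * wl S = t k := by
    have hc := hSS.conj_mem SR (hmem (k + (p + 1 + 1)))
    have hy := hwl _ (sub {t k, t (k + 1)})
    have h1 : wl S * t (k + (p + 1 + 1)) * wl S ∉ S \ {t k, t (k + 1)} := by
      intro h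
      have h2 := hy.conj_mem (subr (sub _)) h
      rw [prc k (p + 1 + 1), ← hP, mul_inv_rev, hy.inv (subr (sub _)), hSS.inv SR] at h2
      have e : wl S * wl (S \ {t k, t (k + 1)}) *
          (wl (S \ {t k, t (k + 1)}) * (wl S * t (k + (p + 1 + 1)) * wl S) *
            wl (S \ {t k, t (k + 1)})) * (wl (S \ {t k, t (k + 1)}) * wl S) =
          wl S * (wl (S \ {t k, t (k + 1)}) *
          (wl (S \ {t k, t (k + 1)}) * (wl S * t (k + (p + 1 + 1)) * wl S) *
            wl (S \ {t k, t (k + 1)})) * wl (S \ {t k, t (k + 1)})) * wl S := by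
        simp only [mul_assoc]
      rw [e, conj_conj (wsq (sub _)), conj_conj wSsq] at h2
      exact h2.2 (by simp)
    by_contra hne0
    apply h1
    refine ⟨hc, ?_⟩
    rintro (h | h)
    · exact hne0 h
    · have h : _ = t (k + 1) := h
      rw [← hs1] at h
      exact hne _ (mul_left_cancel (mul_right_cancel h))
  -- sigma of the set complements
  have hs0' : wl S * t k * wl S = t (k + (p + 1 + 1)) := by rw [← hs0, conj_conj wSsq]
  have hs1' : wl S * t (k + 1) * wl S = t (k + (p + 1 + 1) + 1) := by rw [← hs1, conj_conj wSsq]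
  have inj : ∀ a b : W, wl S * a * wl S = b → a = wl S * b * wl S := by
    rintro a b rfl; rw [conj_conj wSsq]
  have w1 : wl S * wl (S \ {t (k + (p + 1 + 1) + 1)}) * wl S = wl (S \ {t (k + 1)}) := by
    refine hSS.conj_max SR (sub _) (sub _) ?_ ?_ (hwl _ (sub _)) (hwl _ (sub _))
    · rintro a ⟨ha, hb⟩
      refine ⟨hSS.conj_mem SR ha, fun h => hb ?_⟩
      have := inj _ _ h
      rwa [hs1'] at this
    · rintro a ⟨ha, hb⟩
      refine ⟨hSS.conj_mem SR ha, fun h => hb ?_⟩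
      have := inj _ _ h
      rwa [hs1] at this
  have w2 : wl S * wl (S \ {t (k + (p + 1 + 1)), t (k + (p + 1 + 1) + 1)}) * wl S =
      wl (S \ {t k, t (k + 1)}) := by
    refine hSS.conj_max SR (sub _) (sub _) ?_ ?_ (hwl _ (sub _)) (hwl _ (sub _))
    · rintro a ⟨ha, hb⟩
      refine ⟨hSS.conj_mem SR ha, fun h => hb ?_⟩
      rcases h with h | h
      · have := inj _ _ h
        rw [hs0'] at this
        exact Or.inl this
      · have := inj _ _ h
        rw [hs1'] at this
        exact Or.inr this
    · rintro a ⟨ha, hb⟩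
      refine ⟨hSS.conj_mem SR ha, fun h => hb ?_⟩
      rcases h with h | h
      · have := inj _ _ h
        rw [hs0] at this
        exact Or.inl this
      · have := inj _ _ h
        rw [hs1] at this
        exact Or.inr this
  have hfs : wl S * fac S wl t (k + (p + 1 + 1)) * wl S = fac S wl t k := by
    unfold fac
    rw [← w1, ← w2]
    simp only [mul_assoc]
    rw [← mul_assoc (wl S) (wl S), wSsq, one_mul]
  have htop : ∀ u : W, u ∈ Subgroup.closure S := by
    intro u; rw [hS, cs.subgroup_closure_range_simple]; trivial
  have hfl : cs.length (fac S wl t (k + (p + 1 + 1))) = cs.length (fac S wl t k) := by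
    rw [← hfs, hSS.conj_length SR (htop _)]
  have hkk : k + 1 + (p + 1) = k + (p + 1 + 1) := by ring
  -- shifted product
  have hshift : pr S wl t (k + 1) (p + 1 + 1) = wl (S \ {t (k + 1), t (k + 1 + 1)}) * wl S := by
    rw [pr_succ, htail, hkk]
    have : fac S wl t (k + (p + 1 + 1)) = wl S * fac S wl t k * wl S := by
      rw [← hfs, conj_conj wSsq]
    rw [this, fac']
    calc _ = wl (S \ {t (k + 1)}) * (wl S * wl S) * (wl (S \ {t (k + 1)})) *
          wl (S \ {t (k + 1), t (k + 2)}) * wl S := by simp only [mul_assoc]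
      _ = _ := by rw [wSsq, mul_one, wsq (sub _), one_mul]
  have hlenw : cs.length (wl (S \ {t k, t (k + 1)})) =
      cs.length (wl (S \ {t (k + 1), t (k + 1 + 1)})) := by
    rw [← cw k, (hwl _ (sub _)).conj_length (subr (sub _))
      (Subgroup.closure_mono (J2 (k + 1)) (hwl _ (sub _)).1)]
  have hlen : cs.length (wl (S \ {t (k + 1), t (k + 1 + 1)}) * wl S) =
      ∑ j ∈ Finset.range (p + 1 + 1), cs.length (fac S wl t (k + 1 + j)) := by
    have g1 := hSS.mul' SR (htop (wl (S \ {t k, t (k + 1)})))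
    have g2 := hSS.mul' SR (htop (wl (S \ {t (k + 1), t (k + 1 + 1)})))
    have g3 := hsum (p + 1)
    rw [Finset.sum_range_succ, hkk, hfl]
    omega
  have pos : ∀ n, 0 < cs.length (fac S wl t n) := by
    intro n
    rw [Nat.pos_iff_ne_zero, Ne, cs.length_eq_zero_iff]
    exact facne n
  rw [hL'] at hlen
  have mono : StrictMono (fun n => ∑ j ∈ Finset.range n, cs.length (fac S wl t (k + 1 + j))) := by
    apply strictMono_nat_of_lt_succ
    intro n
    rw [Finset.sum_range_succ]
    have := pos (k + 1 + n)
    omega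
  exact mono.injective hlen

end main

end LuoAux


/-!
STATEMENT 1 (invariance of the number of factors). Let (W,S) be the Weyl group of a
finite reduced root system and {s_i}_{i∈ℤ} the bi-infinite Luo sequence generated by
distinct s₀, s₁ ∈ S, with w_i = w_{S∖{s_i}}, w'_i = w_{S∖{s_i,s_{i+1}}}. For each k ≥ 0
let m_k ≥ 1 satisfy (w'_k w_{k+1})⋯(w'_{k+m_k−1}w_{k+m_k}) = w'_k w_S with
Σ_{j=1}^{m_k} ℓ(w'_{k+j−1}w_{k+j}) = ℓ(w'_k w_S). Then all m_k are equal.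
-/

theorem stmt_1 {B W : Type*} [Group W] [Finite W] {M : CoxeterMatrix B}
    (cs : CoxeterSystem M W)
    -- crystallographic condition: (W,S) is the Weyl group of a reduced root system
    (hcrys : ∀ i j : B, i ≠ j → M.M i j ∈ ({2, 3, 4, 6} : Set ℕ))
    (S : Set W) (hS : S = Set.range cs.simple)
    -- longest elements of the standard parabolic subgroups
    (wl : Set W → W)
    (hwl : ∀ J ⊆ S, wl J ∈ Subgroup.closure J ∧
      ∀ u ∈ Subgroup.closure J, cs.length u ≤ cs.length (wl J))
    -- the bi-infinite Luo sequence
    (s : ℤ → W) (hmem : ∀ n : ℤ, s n ∈ S) (h01 : s 0 ≠ s 1)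
    (hrec : ∀ n : ℤ, s (n + 1) = wl (S \ {s n}) * s (n - 1) * wl (S \ {s n}))
    -- the numbers of factors m_k in Luo's decomposition starting at index k
    (mk : ℕ → ℕ)
    (hmk : ∀ k : ℕ, 1 ≤ mk k ∧
      wl (S \ {s k, s (k + 1)}) * wl S =
        ((List.range (mk k)).map
          (fun j => wl (S \ {s (k + j), s (k + j + 1)}) * wl (S \ {s (k + j + 1)}))).prod ∧
      cs.length (wl (S \ {s k, s (k + 1)}) * wl S) =
        ∑ j ∈ Finset.range (mk k),
          cs.length (wl (S \ {s (k + j), s (k + j + 1)}) * wl (S \ {s (k + j + 1)}))) :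
    ∀ k l : ℕ, mk k = mk l := by
  have key := LuoAux.main_step (cs := cs) (S := S) (wl := wl) (t := fun n : ℕ => s n) hS
    (fun J hJ => hwl J hJ) (fun n => hmem n) (by simpa using h01)
    (fun n => by
      have := hrec ((n : ℤ) + 1)
      rw [add_sub_cancel_right, add_assoc] at this
      push_cast
      exact this) mk
    (fun k => by
      have h := hmk k
      have e : (do let a ← List.range (mk k); pure (a : ℤ) : List ℤ) =
          (List.range (mk k)).map (fun a : ℕ => (a : ℤ)) :=
        bind_pure_comp _ _
      rw [e, List.map_map] at h
      unfold LuoAux.pr LuoAux.fac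
      push_cast
      exact h)
  have h0 : ∀ k, mk k = mk 0 := by
    intro k
    induction k with
    | zero => rfl
    | succ k ih => rw [key k, ih]
  intro k l
  rw [h0 k, h0 l]
end

section
/- Let Δ' ⊆ Δ, let α ∈ Δ', and let w ∈ W satisfy w(Δ'∖{α}) ⊆ Δ. If wα is a negative root, then wβ is a negative root for every positive root β ∈ Φ_{Δ'} ∖ Φ_{Δ'∖{α}}; if wα is a positive root, then wβ is a positive root for every such β. -/
/-!
STATEMENT 4. Let Φ be a finite reduced root system in a real vector space with positive
roots Φ⁺ (= Pos), negative roots Φ⁻ (= Neg = −Pos) and simple roots Δ (a linearly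
independent set such that every positive root is a nonnegative combination of Δ).
For Δ' ⊆ Δ, Φ_{Δ'} = Φ ∩ span(Δ') denotes the roots in the span of Δ'.
Let Δ' ⊆ Δ, α ∈ Δ', and let w (an element of the Weyl group; in particular a linear
automorphism permuting Φ) satisfy w(Δ'∖{α}) ⊆ Δ. If wα is negative, then wβ is negative
for every positive root β ∈ Φ_{Δ'} ∖ Φ_{Δ'∖{α}}; if wα is positive, then wβ is positive
for every such β.
-/

theorem exists_dual_aux {V : Type*} [AddCommGroup V] [Module ℝ V] (Δ : Finset V)
    (h : LinearIndependent ℝ (fun x : (Δ : Set V) => (x : V))) (a : V) (ha : a ∈ Δ) :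
    ∃ f : V →ₗ[ℝ] ℝ, f a = 1 ∧ ∀ b ∈ Δ, b ≠ a → f b = 0 := by
  have hn : a ∉ Submodule.span ℝ ((Δ : Set V) \ {a}) := by
    have h2 := h.notMem_span_image (s := {x | (x : V) ≠ a}) (x := ⟨a, by simpa using ha⟩) (by simp)
    intro h3
    apply h2
    convert h3 using 2
    ext y
    simp [and_comm]
  obtain ⟨f, hf, hle⟩ := Submodule.exists_le_ker_of_notMem hn
  refine ⟨(f a)⁻¹ • f, by simp [hf], fun b hb hba => ?_⟩
  have : b ∈ LinearMap.ker f := hle (Submodule.subset_span ⟨by simpa using hb, by simpa using hba⟩)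
  simp [LinearMap.mem_ker.1 this]

theorem stmt_4 {V : Type*} [AddCommGroup V] [Module ℝ V]
    (Φ Pos Neg : Set V) (Δ : Finset V)
    (hfin : Φ.Finite)
    (hΔindep : LinearIndependent ℝ (fun x : (Δ : Set V) => (x : V)))
    -- positive roots: roots which are nonnegative combinations of the simple roots
    (hPos : Pos = {β ∈ Φ | ∃ c : V → ℝ, (∀ δ ∈ Δ, 0 ≤ c δ) ∧ β = ∑ δ ∈ Δ, c δ • δ})
    (hNeg : Neg = (fun β => -β) '' Pos)
    (hΦ : Φ = Pos ∪ Neg)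
    (hΔΦ : (Δ : Set V) ⊆ Φ)
    -- the Weyl group element, acting as a linear automorphism permuting Φ
    (w : V ≃ₗ[ℝ] V) (hw : w '' Φ = Φ)
    (Δ' : Finset V) (hΔ' : Δ' ⊆ Δ) (α : V) (hα : α ∈ Δ')
    (hwΔ' : ∀ δ ∈ Δ', δ ≠ α → w δ ∈ Δ) :
    (w α ∈ Neg → ∀ β ∈ Pos,
        β ∈ (Φ ∩ (Submodule.span ℝ (Δ' : Set V) : Set V)) →
        β ∉ (Φ ∩ (Submodule.span ℝ ((Δ' : Set V) \ {α}) : Set V)) →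
        w β ∈ Neg) ∧
    (w α ∈ Pos → ∀ β ∈ Pos,
        β ∈ (Φ ∩ (Submodule.span ℝ (Δ' : Set V) : Set V)) →
        β ∉ (Φ ∩ (Submodule.span ℝ ((Δ' : Set V) \ {α}) : Set V)) →
        w β ∈ Pos) := by
  classical
  have dual := exists_dual_aux Δ hΔindep
  have hev : ∀ (f : V →ₗ[ℝ] ℝ) (a : V), a ∈ Δ → f a = 1 → (∀ b ∈ Δ, b ≠ a → f b = 0) →
      ∀ c : V → ℝ, f (∑ δ ∈ Δ, c δ • δ) = c a := by
    intro f a ha h1 h0 c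
    rw [map_sum, Finset.sum_eq_single a]
    · simp [h1]
    · intro b hb hba
      simp [h0 b hb hba]
    · intro h
      exact absurd ha h
  have hwΦ : ∀ x ∈ Φ, w x ∈ Φ := fun x hx => hw ▸ Set.mem_image_of_mem w hx
  -- expansion of the relevant roots
  have key : ∀ β ∈ Pos, β ∈ (Φ ∩ (Submodule.span ℝ (Δ' : Set V) : Set V)) →
        β ∉ (Φ ∩ (Submodule.span ℝ ((Δ' : Set V) \ {α}) : Set V)) →
        ∃ c : V → ℝ, (∀ δ ∈ Δ', 0 ≤ c δ) ∧ 0 < c α ∧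
          β = c α • α + ∑ δ ∈ Δ'.erase α, c δ • δ := by
    intro β hβ hβ1 hβ2
    rw [hPos] at hβ
    obtain ⟨hβΦ, c, hc, hβc⟩ := hβ
    have hz : ∀ δ ∈ Δ, δ ∉ Δ' → c δ = 0 := by
      intro δ hδ hδ'
      obtain ⟨f, h1, h0⟩ := dual δ hδ
      rw [← hev f δ hδ h1 h0 c, ← hβc]
      have hle : Submodule.span ℝ (Δ' : Set V) ≤ LinearMap.ker f := by
        rw [Submodule.span_le]
        intro b hb
        have hb' : b ∈ Δ' := hb
        exact h0 b (hΔ' hb') (fun h => hδ' (h ▸ hb'))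
      exact hle hβ1.2
    have e1 : β = ∑ δ ∈ Δ', c δ • δ := by
      rw [hβc]
      symm
      apply Finset.sum_subset hΔ'
      intro x hx hx'
      simp [hz x hx hx']
    have e2 : β = c α • α + ∑ δ ∈ Δ'.erase α, c δ • δ := by
      rw [e1, Finset.add_sum_erase Δ' (fun δ => c δ • δ) hα]
    refine ⟨c, fun δ hδ => hc δ (hΔ' hδ), lt_of_le_of_ne (hc α (hΔ' hα)) ?_, e2⟩
    intro h
    apply hβ2
    refine ⟨hβΦ, ?_⟩
    rw [e2, ← h, zero_smul, zero_add]
    refine Submodule.sum_mem _ fun δ hδ => Submodule.smul_mem _ _ (Submodule.subset_span ?_)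
    rw [Finset.mem_erase] at hδ
    exact ⟨hδ.2, hδ.1⟩
  have posf : ∀ (f : V →ₗ[ℝ] ℝ) (a : V), a ∈ Δ → f a = 1 → (∀ b ∈ Δ, b ≠ a → f b = 0) →
      ∀ x ∈ Pos, 0 ≤ f x := by
    intro f a ha h1 h0 x hx
    rw [hPos] at hx
    obtain ⟨_, c, hc, rfl⟩ := hx
    rw [hev f a ha h1 h0 c]
    exact hc a ha
  have fw : ∀ (f : V →ₗ[ℝ] ℝ) (c : V → ℝ),
      f (w (c α • α + ∑ δ ∈ Δ'.erase α, c δ • δ)) =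
        c α * f (w α) + ∑ δ ∈ Δ'.erase α, c δ * f (w δ) := by
    intro f c
    simp
  constructor
  · intro hneg β hβ hβ1 hβ2
    obtain ⟨c, hc, hcα, hβc⟩ := key β hβ hβ1 hβ2
    rw [hNeg] at hneg
    obtain ⟨γ, hγ, hγw⟩ := hneg
    have hγ' := hγ
    rw [hPos] at hγ'
    obtain ⟨_, d, hd, hγd⟩ := hγ'
    have hex : ∃ a ∈ Δ, d a ≠ 0 ∧ ∀ δ ∈ Δ'.erase α, w δ ≠ a := by
      by_contra hcon
      push Not at hcon
      obtain ⟨f, h1, h0⟩ := dual α (hΔ' hα)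
      have hmem : ∀ a ∈ Δ, f (w.symm (d a • a)) = 0 := by
        intro a ha
        by_cases hda : d a = 0
        · simp [hda]
        · obtain ⟨δ, hδ, rfl⟩ := hcon a ha hda
          rw [Finset.mem_erase] at hδ
          simp [h0 δ (hΔ' hδ.2) hδ.1]
      have e : α = - ∑ δ ∈ Δ, w.symm (d δ • δ) := by
        rw [← map_sum, ← hγd, ← map_neg]
        apply w.injective
        rw [← hγw]
        simp
      have : f α = 0 := by
        rw [e, map_neg, map_sum, Finset.sum_eq_zero hmem, neg_zero]
      linarith
    obtain ⟨a, ha, hda, hane⟩ := hex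
    obtain ⟨f, h1, h0⟩ := dual a ha
    have hfβ : f (w β) = c α * f (w α) := by
      rw [hβc, fw f c, Finset.sum_eq_zero, add_zero]
      intro δ hδ
      have hδ' := Finset.mem_erase.1 hδ
      rw [h0 _ (hwΔ' δ hδ'.2 hδ'.1) (hane δ hδ), mul_zero]
    have hfα : f (w α) = - d a := by
      rw [← hγw, map_neg, hγd, hev f a ha h1 h0 d]
    have hda' : 0 < d a := lt_of_le_of_ne (hd a ha) (Ne.symm hda)
    have hlt : f (w β) < 0 := by
      rw [hfβ, hfα]
      have := mul_pos hcα hda'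
      linarith
    have hm := hwΦ β hβ1.1
    rw [hΦ] at hm
    rcases hm with hm | hm
    · have := posf f a ha h1 h0 _ hm
      linarith
    · exact hm
  · intro hpos β hβ hβ1 hβ2
    obtain ⟨c, hc, hcα, hβc⟩ := key β hβ hβ1 hβ2
    have hnn : ∀ (f : V →ₗ[ℝ] ℝ) (a : V), a ∈ Δ → f a = 1 → (∀ b ∈ Δ, b ≠ a → f b = 0) →
        0 ≤ f (w β) := by
      intro f a ha h1 h0
      rw [hβc, fw f c]
      refine add_nonneg (mul_nonneg hcα.le (posf f a ha h1 h0 _ hpos)) (Finset.sum_nonneg ?_)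
      intro δ hδ
      have hδ' := Finset.mem_erase.1 hδ
      refine mul_nonneg (hc δ hδ'.2) ?_
      by_cases h : w δ = a
      · rw [h, h1]
        exact zero_le_one
      · rw [h0 _ (hwΔ' δ hδ'.2 hδ'.1) h]
    have hm := hwΦ β hβ1.1
    have hm2 := hm
    rw [hΦ] at hm
    rcases hm with hm | hm
    · exact hm
    · rw [hNeg] at hm
      obtain ⟨γ, hγ, hγw⟩ := hm
      rw [hPos] at hγ
      obtain ⟨_, d, hd, hγd⟩ := hγ
      have hw' : w β = ∑ δ ∈ Δ, (-d δ) • δ := by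
        rw [← hγw, hγd]
        simp
      rw [hPos]
      refine ⟨hm2, fun δ => -d δ, ?_, hw'⟩
      intro δ hδ
      obtain ⟨f, h1, h0⟩ := dual δ hδ
      have := hnn f δ hδ h1 h0
      rwa [hw', hev f δ hδ h1 h0 (fun δ => -d δ)] at this
end

section
/- Let u₁, u₂ ∈ W and I₀, I₁, I₂ ⊆ S satisfy u₁⁻¹ I₀ u₁ = I₁ and u₂⁻¹ I₁ u₂ = I₂ (as subsets of S). Suppose u₁ has minimal length in the coset W_{I₀}u₁, u₂ has minimal length in W_{I₁}u₂, and ℓ(u₁u₂) = ℓ(u₁) + ℓ(u₂). Then u₁u₂ has minimal length in the coset W_{I₀}u₁u₂. -/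
open CoxeterSystem in
theorem aux_alt_pow {B G : Type*} [Monoid G] (f : B → G) (i i' : B) (m : ℕ) :
    ((alternatingWord i i' (2 * m)).map f).prod = (f i * f i') ^ m := by
  induction m with
  | zero => simp [alternatingWord]
  | succ m ih =>
    rw [show 2 * (m + 1) = 2 * m + 1 + 1 by ring, alternatingWord_succ', alternatingWord_succ']
    simp [ih, pow_succ', mul_assoc, parity_simps]

theorem aux_comm {W : Type*} [Group W] (a b : W) (ha : a * a = 1) (hb : b * b = 1) (k : ℕ) :
    ((a * b) ^ k)⁻¹ * b = b * (a * b) ^ k := by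
  have ha' : a⁻¹ = a := inv_eq_of_mul_eq_one_right ha
  have hb' : b⁻¹ = b := inv_eq_of_mul_eq_one_right hb
  induction k with
  | zero => simp
  | succ k ih =>
    rw [pow_succ, mul_inv_rev, mul_assoc, ih, ← pow_succ, pow_succ', mul_inv_rev, ha', hb']
    simp only [mul_assoc]

open CoxeterSystem in
theorem aux_ris_alt {B W : Type*} [Group W] {M : CoxeterMatrix B} (cs : CoxeterSystem M W)
    (i i' : B) (m : ℕ) :
    (cs.rightInvSeq (alternatingWord i i' (2 * m))).Perm
      ((List.range (2 * m)).map fun k => cs.simple i' * (cs.simple i * cs.simple i') ^ k) := by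
  induction m with
  | zero => simp [alternatingWord]
  | succ m ih =>
    have hp : cs.wordProd (alternatingWord i i' (2 * m)) = (cs.simple i * cs.simple i') ^ m :=
      aux_alt_pow cs.simple i i' m
    have hc := aux_comm (cs.simple i) (cs.simple i') (by simp) (by simp) m
    rw [show 2 * (m + 1) = 2 * m + 1 + 1 by ring, alternatingWord_succ', alternatingWord_succ',
      List.range_succ, List.range_succ]
    have e1 : ¬ Even (2 * m + 1) := by simp [parity_simps]
    have e2 : Even (2 * m) := by simp
    rw [if_neg e1, if_pos e2]
    simp only [rightInvSeq, List.map_append, List.map_cons, List.map_nil, cs.wordProd_cons, hp]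
    have a1 : ((cs.simple i * cs.simple i') ^ m)⁻¹ * cs.simple i' * (cs.simple i * cs.simple i') ^ m
        = cs.simple i' * (cs.simple i * cs.simple i') ^ (2 * m) := by
      rw [hc, mul_assoc, ← pow_add, two_mul]
    have a2 : (cs.simple i' * (cs.simple i * cs.simple i') ^ m)⁻¹ * cs.simple i *
        (cs.simple i' * (cs.simple i * cs.simple i') ^ m)
        = cs.simple i' * (cs.simple i * cs.simple i') ^ (2 * m + 1) := by
      rw [mul_inv_rev, cs.inv_simple, hc, show 2 * m + 1 = m + 1 + m by ring, pow_add, pow_add]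
      simp only [mul_assoc, pow_one]
    rw [a1, a2]
    refine List.Perm.trans ?_ (List.perm_append_comm)
    simp only [List.singleton_append]
    refine List.Perm.cons _ ?_
    refine List.Perm.trans ?_ (List.perm_append_comm)
    exact List.Perm.cons _ ih

open Classical in
/-- The basic involution. -/
noncomputable def auxF {B W : Type*} [Group W] {M : CoxeterMatrix B} (cs : CoxeterSystem M W)
    (i : B) : Function.End (W × ZMod 2) :=
  fun p => (cs.simple i * p.1 * cs.simple i, p.2 + if p.1 = cs.simple i then 1 else 0)

open Classical in
theorem auxF_prod {B W : Type*} [Group W] {M : CoxeterMatrix B} (cs : CoxeterSystem M W)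
    (ω : List B) (p : W × ZMod 2) :
    ((ω.map (auxF cs)).prod : Function.End (W × ZMod 2)) p =
      (cs.wordProd ω * p.1 * (cs.wordProd ω)⁻¹,
        p.2 + ((cs.rightInvSeq ω).count p.1 : ZMod 2)) := by
  induction ω with
  | nil => simp; rfl
  | cons i ω ih =>
    rw [List.map_cons, List.prod_cons]
    change auxF cs i (((ω.map (auxF cs)).prod : Function.End (W × ZMod 2)) p) = _
    rw [ih]
    unfold auxF
    have : (cs.wordProd ω * p.1 * (cs.wordProd ω)⁻¹ = cs.simple i) ↔
        ((cs.wordProd ω)⁻¹ * cs.simple i * cs.wordProd ω = p.1) := by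
      constructor
      · intro h; rw [← h]; group
      · intro h; rw [← h]; group
    ext
    · simp [cs.wordProd_cons, mul_assoc]
    · simp only [CoxeterSystem.rightInvSeq, List.count_cons, this, beq_iff_eq]
      push_cast
      ring

theorem auxF_lift {B W : Type*} [Group W] {M : CoxeterMatrix B} (cs : CoxeterSystem M W) :
    M.IsLiftable (auxF cs) := by
  classical
  intro i i'
  rw [← aux_alt_pow]
  funext p
  rw [auxF_prod]
  have hp : cs.wordProd (CoxeterSystem.alternatingWord i i' (2 * M i i')) = 1 := by
    have := aux_alt_pow cs.simple i i' (M i i')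
    rw [cs.simple_mul_simple_pow] at this
    exact this
  have hc : ((cs.rightInvSeq (CoxeterSystem.alternatingWord i i' (2 * M i i'))).count p.1
      : ZMod 2) = 0 := by
    rw [(aux_ris_alt cs i i' (M i i')).count_eq, two_mul, List.range_add, List.map_append,
      List.count_append, List.map_map]
    have : ((fun k => cs.simple i' * (cs.simple i * cs.simple i') ^ k) ∘ fun x => M i i' + x)
      = (fun k => cs.simple i' * (cs.simple i * cs.simple i') ^ k) := by
      funext k; simp [pow_add]
    rw [this]
    push_cast
    exact CharTwo.add_self_eq_zero _
  rw [hp, hc]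
  simp
  rfl

open Classical in
theorem aux_count_ris {B W : Type*} [Group W] {M : CoxeterMatrix B} (cs : CoxeterSystem M W)
    (ω ω' : List B) (h : cs.wordProd ω = cs.wordProd ω') (t : W) :
    ((cs.rightInvSeq ω).count t : ZMod 2) = (cs.rightInvSeq ω').count t := by
  have key : ∀ ω : List B, cs.lift ⟨auxF cs, auxF_lift cs⟩ (cs.wordProd ω) =
      (ω.map (auxF cs)).prod := by
    intro ω
    induction ω with
    | nil => simp
    | cons i ω ih => rw [cs.wordProd_cons, map_mul, ih]; simp
  have h2 := key ω
  rw [h, key ω'] at h2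
  have h3 := congrArg Prod.snd (congrFun h2 (t, 0))
  rw [auxF_prod, auxF_prod] at h3
  simpa using h3.symm

open Classical in
theorem aux_count_lis {B W : Type*} [Group W] {M : CoxeterMatrix B} (cs : CoxeterSystem M W)
    (ω ω' : List B) (h : cs.wordProd ω = cs.wordProd ω') (t : W) :
    ((cs.leftInvSeq ω).count t : ZMod 2) = (cs.leftInvSeq ω').count t := by
  have := aux_count_ris cs ω.reverse ω'.reverse (by simp [h]) t
  simpa [cs.rightInvSeq_reverse] using this

theorem aux_lis_append {B W : Type*} [Group W] {M : CoxeterMatrix B} (cs : CoxeterSystem M W)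
    (ω ω' : List B) : cs.leftInvSeq (ω ++ ω') =
      cs.leftInvSeq ω ++ (cs.leftInvSeq ω').map (MulAut.conj (cs.wordProd ω)) := by
  induction ω with
  | nil => simp
  | cons i ω ih =>
    simp only [List.cons_append, CoxeterSystem.leftInvSeq, ih, List.map_append, List.map_map]
    congr 2
    apply List.map_congr_left
    intro a _
    simp [cs.wordProd_cons, mul_assoc]

theorem aux_word {B W : Type*} [Group W] {M : CoxeterMatrix B} (cs : CoxeterSystem M W)
    (I : Set B) (x : W) (hx : x ∈ Subgroup.closure (cs.simple '' I)) :
    ∃ ω : List B, cs.wordProd ω = x ∧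
      ∀ t ∈ cs.leftInvSeq ω, t ∈ Subgroup.closure (cs.simple '' I) := by
  induction hx using Subgroup.closure_induction_left with
  | one => exact ⟨[], by simp⟩
  | mul_left a ha y hy ih =>
    obtain ⟨i, hi, rfl⟩ := ha
    obtain ⟨ω, rfl, h⟩ := ih
    refine ⟨i :: ω, cs.wordProd_cons i ω, ?_⟩
    have hs := Subgroup.subset_closure (Set.mem_image_of_mem cs.simple hi)
    intro t ht
    simp only [CoxeterSystem.leftInvSeq, List.mem_cons, List.mem_map] at ht
    obtain rfl | ⟨r, hr, rfl⟩ := ht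
    · exact hs
    · exact mul_mem (mul_mem hs (h r hr)) (inv_mem hs)
  | inv_mul_cancel a ha y hy ih =>
    obtain ⟨i, hi, rfl⟩ := ha
    obtain ⟨ω, rfl, h⟩ := ih
    refine ⟨i :: ω, by rw [cs.wordProd_cons, cs.inv_simple], ?_⟩
    have hs := Subgroup.subset_closure (Set.mem_image_of_mem cs.simple hi)
    intro t ht
    simp only [CoxeterSystem.leftInvSeq, List.mem_cons, List.mem_map] at ht
    obtain rfl | ⟨r, hr, rfl⟩ := ht
    · exact hs
    · exact mul_mem (mul_mem hs (h r hr)) (inv_mem hs)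

theorem stmt_6 {B W : Type*} [Group W] {M : CoxeterMatrix B} (cs : CoxeterSystem M W)
    (I₀ I₁ I₂ : Set B) (u₁ u₂ : W)
    (h₁ : (fun x => u₁⁻¹ * x * u₁) '' (cs.simple '' I₀) = cs.simple '' I₁)
    (h₂ : (fun x => u₂⁻¹ * x * u₂) '' (cs.simple '' I₁) = cs.simple '' I₂)
    (hmin₁ : ∀ x ∈ Subgroup.closure (cs.simple '' I₀),
      cs.length u₁ ≤ cs.length (x * u₁))
    (hmin₂ : ∀ x ∈ Subgroup.closure (cs.simple '' I₁),
      cs.length u₂ ≤ cs.length (x * u₂))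
    (hadd : cs.length (u₁ * u₂) = cs.length u₁ + cs.length u₂) :
    ∀ x ∈ Subgroup.closure (cs.simple '' I₀),
      cs.length (u₁ * u₂) ≤ cs.length (x * (u₁ * u₂)) := by
  classical
  intro x hx
  obtain ⟨a, ha, rfl⟩ := cs.exists_isReduced u₁
  obtain ⟨b, hb, rfl⟩ := cs.exists_isReduced u₂
  obtain ⟨c, rfl, hc⟩ := aux_word cs I₀ x hx
  have hab : cs.IsReduced (a ++ b) := by
    unfold CoxeterSystem.IsReduced at *
    rw [cs.wordProd_append, hadd, ha, hb, List.length_append]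
  have hconj : ∀ y ∈ Subgroup.closure (cs.simple '' I₀),
      (cs.wordProd a)⁻¹ * y * cs.wordProd a ∈ Subgroup.closure (cs.simple '' I₁) := by
    intro y hy
    have hle : Subgroup.closure (cs.simple '' I₀) ≤
        (Subgroup.closure (cs.simple '' I₁)).comap
          (MulAut.conj (cs.wordProd a)⁻¹).toMonoidHom := by
      rw [Subgroup.closure_le]
      intro z hz
      have : (cs.wordProd a)⁻¹ * z * cs.wordProd a ∈ cs.simple '' I₁ := by
        rw [← h₁]; exact ⟨z, hz, rfl⟩
      simpa using Subgroup.subset_closure this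
    simpa using hle hy
  have hout : ∀ t ∈ cs.leftInvSeq (a ++ b), t ∉ Subgroup.closure (cs.simple '' I₀) := by
    intro t ht htI
    rw [aux_lis_append, List.mem_append, List.mem_map] at ht
    rcases ht with ht | ⟨r, hr, rfl⟩
    · have := (cs.isLeftInversion_of_mem_leftInvSeq ha ht).2
      have := hmin₁ t htI
      omega
    · have h3 := (cs.isLeftInversion_of_mem_leftInvSeq hb hr).2
      have h4 := hconj _ htI
      rw [MulAut.conj_apply] at h4
      have h5 := hmin₂ r (by simpa [mul_assoc] using h4)
      omega
  obtain ⟨d, hd, hd'⟩ := cs.exists_isReduced (cs.wordProd c * (cs.wordProd a * cs.wordProd b))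
  have hnd : ((cs.leftInvSeq (a ++ b)).map (MulAut.conj (cs.wordProd c))).Nodup :=
    (CoxeterSystem.IsReduced.nodup_leftInvSeq cs hab).map (MulAut.conj (cs.wordProd c)).injective
  have hsub : ((cs.leftInvSeq (a ++ b)).map (MulAut.conj (cs.wordProd c))) ⊆ cs.leftInvSeq d := by
    intro t ht
    have h6 := aux_count_lis cs (c ++ (a ++ b)) d
      (by rw [← hd', cs.wordProd_append, cs.wordProd_append]) t
    rw [aux_lis_append cs c, List.count_append, List.count_eq_one_of_mem hnd ht] at h6
    have h7 : t ∉ cs.leftInvSeq c := by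
      intro h
      obtain ⟨r, hr, rfl⟩ := List.mem_map.1 ht
      have h8 := hc _ h
      rw [MulAut.conj_apply] at h8
      refine hout r hr ?_
      have := mul_mem (mul_mem (inv_mem hx) h8) hx
      simpa [mul_assoc] using this
    rw [List.count_eq_zero_of_not_mem h7] at h6
    by_contra h9
    rw [List.count_eq_zero_of_not_mem h9] at h6
    simp at h6
  have hlen := (hnd.subperm hsub).length_le
  rw [List.length_map, cs.length_leftInvSeq, cs.length_leftInvSeq] at hlen
  rw [hd', hd.eq, ← cs.wordProd_append, hab.eq]
  exact hlen
end

section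
/- Let u₁, …, u_k ∈ W and I₀, I₁, …, I_k ⊆ S satisfy u_i⁻¹ I_{i−1} u_i = I_i for each i, suppose each u_i has minimal length in W_{I_{i−1}} u_i = u_i W_{I_i}, and suppose ℓ(u₁⋯u_k) = ℓ(u₁) + ⋯ + ℓ(u_k). Then u₁⋯u_k has minimal length in W_{I₀} u₁⋯u_k, and in the group algebra ℂG one has a_{P_{I₀} u₁ P_{I₁}} · a_{P_{I₁} u₂ P_{I₂}} ⋯ a_{P_{I_{k−1}} u_k P_{I_k}} = a_{P_{I₀} (u₁⋯u_k) P_{I_k}}. -/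
/-!
STATEMENT 7. Let G be a finite group with a BN-pair, with Weyl group W = N/(B ∩ N)
generated by the set S of involutions, standard parabolics P_I = B W_I B, and
a_{PwQ} = |Q|⁻¹ Σ_{x ∈ PwQ} x ∈ ℂG. Let u₁, …, u_k ∈ W and I₀, …, I_k ⊆ S satisfy
u_i⁻¹ I_{i−1} u_i = I_i, suppose each u_i has minimal length in W_{I_{i−1}} u_i, and
suppose ℓ(u₁⋯u_k) = ℓ(u₁) + ⋯ + ℓ(u_k). Then u₁⋯u_k has minimal length in
W_{I₀} u₁⋯u_k, and a_{P_{I₀}u₁P_{I₁}} ⋯ a_{P_{I_{k−1}}u_kP_{I_k}} = a_{P_{I₀}(u₁⋯u_k)P_{I_k}}.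
-/


open scoped Pointwise

variable {G : Type*} [Group G]

/-- The set of lifts in `G` of an element of the Weyl group `W = N/(B ⊓ N)` of a
BN-pair. (All statements about double cosets `BwB` are independent of the lift.) -/
def lifts (B N : Subgroup G) (w : ↥N ⧸ (B ⊓ N).subgroupOf N) : Set G :=
  {g : G | ∃ x : ↥N, QuotientGroup.mk x = w ∧ g = (x : G)}

/-- The double coset `BwB ⊆ G`, for `w` in the Weyl group. -/
def BwB (B N : Subgroup G) (w : ↥N ⧸ (B ⊓ N).subgroupOf N) : Set G :=
  (B : Set G) * lifts B N w * (B : Set G)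

/-- The standard parabolic subgroup `P_I = B W_I B ⊆ G` (as a subset of `G`),
for a subset `I` of the Weyl group. -/
def para (B N : Subgroup G) [((B ⊓ N).subgroupOf N).Normal] (I : Set (↥N ⧸ (B ⊓ N).subgroupOf N)) : Set G :=
  {g : G | ∃ w ∈ Subgroup.closure I, g ∈ BwB B N w}

/-- Word length with respect to a generating set `S`. -/
noncomputable def wordLen {W : Type*} [Monoid W] (S : Set W) (w : W) : ℕ :=
  sInf {m | ∃ L : List W, L.length = m ∧ (∀ x ∈ L, x ∈ S) ∧ L.prod = w}

/-- The element `a_{PwQ} = |Q|⁻¹ Σ_{x ∈ PwQ} x` of the group algebra `ℂG`. -/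
noncomputable def aPwQ [Fintype G] (B N : Subgroup G) (P : Set G)
    (w : ↥N ⧸ (B ⊓ N).subgroupOf N) (Q : Set G) : MonoidAlgebra ℂ G :=
  ((Q.ncard : ℂ))⁻¹ •
    ∑ x ∈ (Set.toFinite (P * lifts B N w * Q)).toFinset, MonoidAlgebra.single x (1 : ℂ)

/-- The idempotent `e_P = |P|⁻¹ Σ_{x ∈ P} x` of the group algebra `ℂG`. -/
noncomputable def ePset [Fintype G] (P : Set G) : MonoidAlgebra ℂ G :=
  ((P.ncard : ℂ))⁻¹ • ∑ x ∈ (Set.toFinite P).toFinset, MonoidAlgebra.single x (1 : ℂ)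


/-! ## word length -/
section WL
variable {W : Type*} [Group W] {S : Set W}

theorem wl_le (L : List W) (h : ∀ x ∈ L, x ∈ S) : wordLen S L.prod ≤ L.length :=
  Nat.sInf_le ⟨L, rfl, h, rfl⟩

theorem closure_list {I : Set W} (hI : ∀ s ∈ I, s * s = 1) {x : W}
    (hx : x ∈ Subgroup.closure I) : ∃ L : List W, (∀ y ∈ L, y ∈ I) ∧ L.prod = x := by
  induction hx using Subgroup.closure_induction_left with
  | one => exact ⟨[], by simp, rfl⟩
  | mul_left s hs y hy ih =>
    obtain ⟨L, h1, h2⟩ := ih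
    exact ⟨s :: L, by simpa using ⟨hs, h1⟩, by simp [h2]⟩
  | inv_mul_cancel s hs y hy ih =>
    obtain ⟨L, h1, h2⟩ := ih
    refine ⟨s :: L, by simpa using ⟨hs, h1⟩, ?_⟩
    rw [List.prod_cons, h2, inv_eq_of_mul_eq_one_right (hI s hs)]

theorem list_closure {I : Set W} (L : List W) (h : ∀ y ∈ L, y ∈ I) :
    L.prod ∈ Subgroup.closure I :=
  Subgroup.list_prod_mem _ fun y hy => Subgroup.subset_closure (h y hy)

theorem wl_ex' {x : W} (h : ∃ L : List W, (∀ y ∈ L, y ∈ S) ∧ L.prod = x) :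
    ∃ L : List W, L.length = wordLen S x ∧ (∀ y ∈ L, y ∈ S) ∧ L.prod = x := by
  obtain ⟨L, h1, h2⟩ := h
  exact Nat.sInf_mem (s := {m | ∃ L : List W, L.length = m ∧ (∀ x ∈ L, x ∈ S) ∧ L.prod = x})
    ⟨_, L, rfl, h1, h2⟩

end WL

/-- Abstract double coset system. -/
structure DS {W G : Type*} [Group W] [Group G] (S : Set W) (D : W → Set G) : Prop where
  gen : Subgroup.closure S = ⊤
  inv : ∀ s ∈ S, s * s = 1
  ne1 : ∀ s ∈ S, s ≠ 1
  one : (1 : G) ∈ D 1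
  Dinv : ∀ w g, g ∈ D w → g⁻¹ ∈ D w⁻¹
  ne : ∀ w, (D w).Nonempty
  eq : ∀ g w v, g ∈ D w → g ∈ D v → D w = D v
  sub : ∀ g w v, g ∈ D (w * v) → ∃ x ∈ D w, ∃ y ∈ D v, x * y = g
  d1 : ∀ w, D w = D 1 → w = 1
  ax1 : ∀ s ∈ S, ∀ w, ∀ x ∈ D s, ∀ y ∈ D w, x * y ∈ D (s * w) ∨ x * y ∈ D w
  ax2 : ∀ s ∈ S, ∃ x ∈ D s, ∃ y ∈ D s, x * y ∉ D 1
  l1 : ∀ w, ∀ x ∈ D 1, ∀ y ∈ D w, x * y ∈ D w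

namespace DS
section
variable {W G : Type*} [Group W] [Group G] {S : Set W} {D : W → Set G}

theorem ex (h : DS S D) (w : W) :
    ∃ L : List W, L.length = wordLen S w ∧ (∀ y ∈ L, y ∈ S) ∧ L.prod = w :=
  wl_ex' (closure_list h.inv (by rw [h.gen]; trivial))

theorem sinv (h : DS S D) {s : W} (hs : s ∈ S) : s⁻¹ = s :=
  inv_eq_of_mul_eq_one_right (h.inv s hs)

theorem ssw (h : DS S D) {s : W} (hs : s ∈ S) (w : W) : s * (s * w) = w := by
  rw [← mul_assoc, h.inv s hs, one_mul]

theorem wss (h : DS S D) {s : W} (hs : s ∈ S) (w : W) : w * s * s = w := by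
  rw [mul_assoc, h.inv s hs, mul_one]

theorem wl_one (_h : DS S D) : wordLen S (1 : W) = 0 := by
  have := wl_le (S := S) [] (by simp)
  simpa using this

theorem wl_zero (h : DS S D) {w : W} (hw : wordLen S w = 0) : w = 1 := by
  obtain ⟨L, h1, h2, h3⟩ := h.ex w
  rw [hw, List.length_eq_zero_iff] at h1
  simp [← h3, h1]

theorem wl_mul (h : DS S D) (u v : W) : wordLen S (u * v) ≤ wordLen S u + wordLen S v := by
  obtain ⟨L, h1, h2, h3⟩ := h.ex u
  obtain ⟨L', h1', h2', h3'⟩ := h.ex v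
  have := wl_le (S := S) (L ++ L') (by
    intro x hx
    rcases List.mem_append.1 hx with hx | hx
    · exact h2 x hx
    · exact h2' x hx)
  rw [List.prod_append, List.length_append, h3, h3'] at this
  omega

theorem wl_inv_le (h : DS S D) (u : W) : wordLen S u⁻¹ ≤ wordLen S u := by
  obtain ⟨L, h1, h2, h3⟩ := h.ex u
  have e : (L.reverse).prod = u⁻¹ := by
    rw [← h3, List.prod_inv_reverse]
    congr 2
    symm
    calc L.map (fun x => x⁻¹) = L.map id := List.map_congr_left fun a ha => h.sinv (h2 a ha)
      _ = L := by simp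
  have := wl_le (S := S) L.reverse (by simpa using h2)
  rw [e, List.length_reverse] at this
  omega

theorem wl_inv (h : DS S D) (u : W) : wordLen S u⁻¹ = wordLen S u := by
  apply le_antisymm (h.wl_inv_le u)
  simpa using h.wl_inv_le u⁻¹

theorem wl_s (_h : DS S D) {s : W} (hs : s ∈ S) : wordLen S s ≤ 1 := by
  simpa using wl_le (S := S) [s] (by simpa using hs)

theorem wl_sw (h : DS S D) {s : W} (hs : s ∈ S) (w : W) :
    wordLen S (s * w) ≤ wordLen S w + 1 := by
  have := h.wl_mul s w
  have := h.wl_s hs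
  omega

theorem wl_ws (h : DS S D) {s : W} (hs : s ∈ S) (w : W) :
    wordLen S (w * s) ≤ wordLen S w + 1 := by
  have := h.wl_mul w s
  have := h.wl_s hs
  omega

theorem wl_sw' (h : DS S D) {s : W} (hs : s ∈ S) (w : W) :
    wordLen S w ≤ wordLen S (s * w) + 1 := by
  have := h.wl_sw hs (s * w)
  rwa [h.ssw hs] at this

/-- peel a left letter -/
theorem peelL (h : DS S D) {w : W} {n : ℕ} (hw : wordLen S w = n + 1) :
    ∃ s ∈ S, ∃ v, w = s * v ∧ wordLen S v = n := by
  obtain ⟨L, h1, h2, h3⟩ := h.ex w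
  cases L with
  | nil => simp at h1; omega
  | cons s L =>
    have hs : s ∈ S := h2 s (by simp)
    refine ⟨s, hs, L.prod, by simp [← h3], ?_⟩
    have a := wl_le (S := S) L (fun x hx => h2 x (by simp [hx]))
    have b := h.wl_sw hs L.prod
    simp at h1 h3
    rw [h3] at b
    omega

theorem peelR (h : DS S D) {w : W} {n : ℕ} (hw : wordLen S w = n + 1) :
    ∃ s ∈ S, ∃ v, w = v * s ∧ wordLen S v = n := by
  obtain ⟨s, hs, v, e, hv⟩ := h.peelL (w := w⁻¹) (n := n) (by rw [h.wl_inv, hw])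
  refine ⟨s, hs, v⁻¹, ?_, by rw [h.wl_inv, hv]⟩
  rw [← inv_inj, e, mul_inv_rev, inv_inv, h.sinv hs]

theorem inj_aux (h : DS S D) (n : ℕ) : ∀ w w' : W, wordLen S w = n → n ≤ wordLen S w' →
    D w = D w' → w = w' := by
  induction n with
  | zero =>
    intro w w' hw _ e
    have := h.wl_zero hw
    subst this
    exact (h.d1 w' e.symm).symm
  | succ n ih =>
    intro w w' hw hw' e
    obtain ⟨s, hs, v, rfl, hv⟩ := h.peelL hw
    obtain ⟨g, hg⟩ := h.ne v
    have hg' := hg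
    rw [← h.ssw hs v] at hg'
    obtain ⟨x, hx, y, hy, rfl⟩ := h.sub _ _ _ hg'
    rw [e] at hy
    rcases h.ax1 s hs w' x hx y hy with h1 | h1
    · have := h.wl_sw' hs w'
      have := ih v (s * w') hv (by omega) (h.eq _ _ _ hg h1)
      rw [this, h.ssw hs]
    · have := ih v w' hv (by omega) (h.eq _ _ _ hg h1)
      subst this
      omega

theorem inj (h : DS S D) {g : G} {w w' : W} (h1 : g ∈ D w) (h2 : g ∈ D w') : w = w' := by
  rcases le_total (wordLen S w) (wordLen S w') with hl | hl
  · exact h.inj_aux _ w w' rfl hl (h.eq _ _ _ h1 h2)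
  · exact (h.inj_aux _ w' w rfl hl (h.eq _ _ _ h2 h1)).symm

theorem ax1R (h : DS S D) {s : W} (hs : s ∈ S) {w : W} {x y : G} (hx : x ∈ D w) (hy : y ∈ D s) :
    x * y ∈ D (w * s) ∨ x * y ∈ D w := by
  have hy' := h.Dinv _ _ hy
  rw [h.sinv hs] at hy'
  rcases h.ax1 s hs _ _ hy' _ (h.Dinv _ _ hx) with h1 | h1
  · left
    simpa [h.sinv hs] using h.Dinv _ _ h1
  · right
    simpa using h.Dinv _ _ h1

theorem fold (h : DS S D) {s t w : W} (hs : s ∈ S) (ht : t ∈ S)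
    (h1 : ∀ x ∈ D s, ∀ y ∈ D w, x * y ∈ D (s * w))
    {x y : G} (hx : x ∈ D s) (hy : y ∈ D (w * t)) (hxy : x * y ∈ D (w * t)) : s * w = w * t := by
  obtain ⟨a, ha, c, hc, rfl⟩ := h.sub _ _ _ hy
  have hc' := h.Dinv _ _ hc
  rw [h.sinv ht] at hc'
  have e : x * (a * c) * c⁻¹ = x * a := by group
  have hxa := h1 x hx a ha
  rcases h.ax1R ht hxy hc' with h2 | h2
  · rw [e, h.wss ht] at h2
    have := h.inj hxa h2
    exact absurd (mul_eq_right.1 this) (h.ne1 s hs)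
  · rw [e] at h2
    exact h.inj hxa h2

theorem up_aux (h : DS S D) {s : W} (hs : s ∈ S) (n : ℕ) : ∀ w : W, wordLen S w = n →
    n ≤ wordLen S (s * w) → ∀ x ∈ D s, ∀ y ∈ D w, x * y ∈ D (s * w) := by
  induction n with
  | zero =>
    intro w hw _ x hx y hy
    have := h.wl_zero hw
    subst this
    rw [mul_one]
    have := h.l1 _ y⁻¹ (by simpa using h.Dinv _ _ hy) _ (h.Dinv _ _ hx)
    simpa using h.Dinv _ _ this
  | succ n ih =>
    intro w hw hsw x hx y hy
    rcases h.ax1 s hs w x hx y hy with h1 | h1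
    · exact h1
    exfalso
    obtain ⟨t, ht, v, rfl, hv⟩ := h.peelR hw
    have a := h.wl_ws ht (s * v)
    rw [mul_assoc] at a
    have := h.fold hs ht (ih v hv (by omega)) hx hy h1
    rw [← this, h.ssw hs] at hsw
    omega

theorem up (h : DS S D) {s : W} (hs : s ∈ S) {w : W} (hl : wordLen S w ≤ wordLen S (s * w))
    {x y : G} (hx : x ∈ D s) (hy : y ∈ D w) : x * y ∈ D (s * w) :=
  h.up_aux hs _ w rfl hl x hx y hy

theorem down (h : DS S D) {s : W} (hs : s ∈ S) {w : W} (hl : wordLen S (s * w) ≤ wordLen S w) :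
    ∃ x ∈ D s, ∃ y ∈ D w, x * y ∈ D w := by
  obtain ⟨p, hp, q, hq, hpq⟩ := h.ax2 s hs
  have hr : p * q ∈ D s := by
    rcases h.ax1 s hs s p hp q hq with h1 | h1
    · rw [h.inv s hs] at h1
      exact absurd h1 hpq
    · exact h1
  obtain ⟨y, hy⟩ := h.ne (s * w)
  have key : ∀ x ∈ D s, x * y ∈ D w := by
    intro x hx
    have := h.up hs (w := s * w) (by rwa [h.ssw hs]) hx hy
    rwa [h.ssw hs] at this
  refine ⟨p, hp, q * y, key q hq, ?_⟩
  rw [← mul_assoc]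
  exact key _ hr

theorem folding (h : DS S D) {s t w : W} (hs : s ∈ S) (ht : t ∈ S)
    (h1 : wordLen S w ≤ wordLen S (s * w)) (h2 : wordLen S (s * (w * t)) ≤ wordLen S (w * t)) :
    s * w = w * t := by
  obtain ⟨x, hx, y, hy, hxy⟩ := h.down hs h2
  exact h.fold hs ht (fun x hx y hy => h.up hs h1 hx hy) hx hy hxy

theorem exch (h : DS S D) {s u : W} (hs : s ∈ S) (h1 : wordLen S u ≤ wordLen S (s * u))
    (L : List W) (hL : ∀ x ∈ L, x ∈ S)
    (h2 : wordLen S (s * (u * L.prod)) ≤ wordLen S (u * L.prod)) :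
    (∃ L' : List W, L'.Sublist L ∧ L'.length < L.length ∧ s * (u * L.prod) = u * L'.prod)
      ∨ (L = [] ∧ wordLen S (s * u) ≤ wordLen S u) := by
  induction L using List.reverseRecOn with
  | nil => right; simpa using h2
  | append_singleton L t ih =>
    left
    have ht : t ∈ S := hL t (by simp)
    have hL' : ∀ x ∈ L, x ∈ S := fun x hx => hL x (by simp [hx])
    have e : (L ++ [t]).prod = L.prod * t := by simp
    by_cases hc : wordLen S (u * L.prod) ≤ wordLen S (s * (u * L.prod))
    · have := h.folding hs ht hc (by rw [mul_assoc, ← e]; exact h2)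
      refine ⟨L, by simp, by simp, ?_⟩
      rw [e, ← mul_assoc u, ← mul_assoc s, this, h.wss ht]
    · rcases ih hL' (by omega) with ⟨L', a, b, c⟩ | ⟨a, b⟩
      · refine ⟨L' ++ [t], a.append_right _, by simpa using b, ?_⟩
        rw [e, ← mul_assoc u, ← mul_assoc s, c]
        simp [mul_assoc]
      · subst a
        simp at hc
        omega

/-- strictness -/
theorem strict (h : DS S D) {s u : W} (hs : s ∈ S) : wordLen S (s * u) ≠ wordLen S u := by
  intro e
  obtain ⟨L, h1, h2, h3⟩ := h.ex u
  have h0 := h.wl_one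
  rcases h.exch hs (u := 1) (by omega) L h2 (by rw [h3]; simp [e]) with ⟨L', a, b, c⟩ | ⟨a, b⟩
  · have := wl_le (S := S) L' (fun x hx => h2 x (a.subset hx))
    simp [h3] at c
    rw [c] at e
    omega
  · rw [mul_one, h0] at b
    exact h.ne1 s hs (h.wl_zero (by omega))

end
end DS

namespace DS
section
variable {W G : Type*} [Group W] [Group G] {S : Set W} {D : W → Set G}

theorem exch' (h : DS S D) {s u : W} (hs : s ∈ S) (h1 : wordLen S u ≤ wordLen S (s * u))
    (L : List W) (hL : ∀ x ∈ L, x ∈ S)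
    (h2 : wordLen S (s * (u * L.prod)) ≤ wordLen S (u * L.prod)) :
    ∃ L' : List W, L'.Sublist L ∧ L'.length < L.length ∧ s * (u * L.prod) = u * L'.prod := by
  rcases h.exch hs h1 L hL h2 with h3 | ⟨_, h3⟩
  · exact h3
  · exact absurd (le_antisymm h3 h1) (h.strict hs)

theorem mlen_aux (h : DS S D) {I : Set W} (hI : I ⊆ S) {u : W}
    (hu : ∀ x ∈ Subgroup.closure I, wordLen S u ≤ wordLen S (x * u)) (L : List W) :
    (∀ y ∈ L, y ∈ I) → L.length = wordLen I L.prod →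
    wordLen S (L.prod * u) = L.length + wordLen S u := by
  induction L with
  | nil => simp
  | cons s L ih =>
    intro hL hlen
    have hs : s ∈ I := hL s (by simp)
    have hL0 : ∀ y ∈ L, y ∈ I := fun y hy => hL y (by simp [hy])
    have hmin : L.length = wordLen I L.prod := by
      apply le_antisymm _ (wl_le L hL0)
      obtain ⟨M, a, b, c⟩ := wl_ex' (S := I) ⟨L, hL0, rfl⟩
      have := wl_le (S := I) (s :: M) (by simpa using ⟨hs, b⟩)
      rw [List.prod_cons, c, ← List.prod_cons, ← hlen] at this
      simp at this
      omega
    have IH := ih hL0 hmin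
    have hsS := hI hs
    rw [List.prod_cons, List.length_cons, mul_assoc]
    by_cases hc : wordLen S (s * (L.prod * u)) ≤ wordLen S (L.prod * u)
    · exfalso
      by_cases hd : wordLen S L.prod ≤ wordLen S (s * L.prod)
      · obtain ⟨U, a, b, rfl⟩ := h.ex u
        obtain ⟨U', p, q, r⟩ := h.exch' hsS hd U b hc
        have hz : (L.prod⁻¹ * s * L.prod) ∈ Subgroup.closure I := by
          refine mul_mem (mul_mem (inv_mem ?_) (Subgroup.subset_closure hs)) ?_ <;>
          exact list_closure L hL0
        have h3 := hu _ hz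
        have e : L.prod⁻¹ * s * L.prod * U.prod = U'.prod := by
          rw [mul_assoc, mul_assoc, r]; group
        rw [e] at h3
        have := wl_le (S := S) U' (fun x hx => b x (p.subset hx))
        omega
      · have h0 := h.wl_one
        obtain ⟨L', p, q, r⟩ := h.exch' hsS (u := 1) (by omega) L (fun y hy => hI (hL0 y hy))
          (by simp only [one_mul]; omega)
        simp only [one_mul] at r
        have := wl_le (S := I) L' (fun x hx => hL0 x (p.subset hx))
        rw [← r, ← List.prod_cons, ← hlen] at this
        simp at this
        omega
    · have := h.wl_sw hsS (L.prod * u)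
      omega

theorem invI (h : DS S D) {I : Set W} (hI : I ⊆ S) : ∀ s ∈ I, s * s = 1 :=
  fun s hs => h.inv s (hI hs)

theorem mlen_aux2 (h : DS S D) {I : Set W} (hI : I ⊆ S) {u : W}
    (hu : ∀ x ∈ Subgroup.closure I, wordLen S u ≤ wordLen S (x * u)) {x : W}
    (hx : x ∈ Subgroup.closure I) :
    wordLen S (x * u) = wordLen I x + wordLen S u := by
  obtain ⟨L, a, b, rfl⟩ := wl_ex' (closure_list (h.invI hI) hx)
  rw [h.mlen_aux hI hu L b a, a]

theorem wlI (h : DS S D) {I : Set W} (hI : I ⊆ S) {x : W} (hx : x ∈ Subgroup.closure I) :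
    wordLen S x = wordLen I x := by
  have h0 := h.wl_one
  have := h.mlen_aux2 hI (u := 1) (by intro x _; omega) hx
  simpa [h0] using this

theorem mlen (h : DS S D) {I : Set W} (hI : I ⊆ S) {u : W}
    (hu : ∀ x ∈ Subgroup.closure I, wordLen S u ≤ wordLen S (x * u)) {x : W}
    (hx : x ∈ Subgroup.closure I) :
    wordLen S (x * u) = wordLen S x + wordLen S u := by
  rw [h.mlen_aux2 hI hu hx, h.wlI hI hx]

theorem min_of_simple (h : DS S D) {I : Set W} (hI : I ⊆ S) {u : W}
    (hu : ∀ s ∈ I, wordLen S u ≤ wordLen S (s * u)) :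
    ∀ x ∈ Subgroup.closure I, wordLen S u ≤ wordLen S (x * u) := by
  obtain ⟨y, hy, hmin⟩ := WellFounded.has_min (measure fun x => wordLen S (x * u)).wf
    {x | x ∈ Subgroup.closure I} ⟨1, (Subgroup.closure I).one_mem⟩
  have hm : ∀ x ∈ Subgroup.closure I, wordLen S (y * u) ≤ wordLen S (x * u) := by
    intro x hx
    have := hmin x hx
    exact not_lt.1 this
  have hm' : ∀ x ∈ Subgroup.closure I, wordLen S (y * u) ≤ wordLen S (x * (y * u)) := by
    intro x hx
    rw [← mul_assoc]
    exact hm _ (mul_mem hx hy)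
  obtain ⟨L, a, b, c⟩ := wl_ex' (closure_list (h.invI hI) (inv_mem hy))
  cases L with
  | nil =>
    simp at c
    subst c
    simpa using hm
  | cons s L =>
    exfalso
    have hs : s ∈ I := b s (by simp)
    have hL : ∀ z ∈ L, z ∈ I := fun z hz => b z (by simp [hz])
    have e1 : s * u = L.prod * (y * u) := by
      have : s * (s * L.prod) = s * y⁻¹ := by rw [← c]; simp
      rw [h.ssw (hI hs)] at this
      rw [this]; group
    have h1 := h.mlen_aux2 hI hm' (inv_mem hy)
    have h2 := h.mlen_aux2 hI hm' (list_closure L hL)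
    have h3 := wl_le (S := I) L hL
    have h4 := hu s hs
    rw [e1] at h4
    simp at h1 a
    omega

theorem part1 (h : DS S D) {I J : Set W} (hI : I ⊆ S) {u v : W}
    (hc : ∀ s ∈ I, u⁻¹ * s * u ∈ J)
    (hu : ∀ x ∈ Subgroup.closure I, wordLen S u ≤ wordLen S (x * u))
    (hv : ∀ x ∈ Subgroup.closure J, wordLen S v ≤ wordLen S (x * v)) :
    ∀ x ∈ Subgroup.closure I, wordLen S (u * v) ≤ wordLen S (x * (u * v)) := by
  apply h.min_of_simple hI
  intro s hs
  by_contra hcon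
  obtain ⟨V, a, b, rfl⟩ := h.ex v
  obtain ⟨V', p, q, r⟩ := h.exch' (hI hs) (hu s (Subgroup.subset_closure hs)) V b (by omega)
  have h3 := hv _ (Subgroup.subset_closure (hc s hs))
  have e : u⁻¹ * s * u * V.prod = V'.prod := by
    rw [mul_assoc, mul_assoc, r]; group
  rw [e] at h3
  have := wl_le (S := S) V' (fun x hx => b x (p.subset hx))
  omega

theorem mulD_aux (h : DS S D) (n : ℕ) : ∀ u v : W, wordLen S u = n →
    wordLen S (u * v) = wordLen S u + wordLen S v →
    ∀ x ∈ D u, ∀ y ∈ D v, x * y ∈ D (u * v) := by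
  induction n with
  | zero =>
    intro u v hu _ x hx y hy
    have := h.wl_zero hu
    subst this
    rw [one_mul]
    exact h.l1 _ _ hx _ hy
  | succ n ih =>
    intro u v hu huv x hx y hy
    obtain ⟨s, hs, u, rfl, hu'⟩ := h.peelL hu
    obtain ⟨a, ha, c, hc, rfl⟩ := h.sub _ _ _ hx
    have h1 := h.wl_mul u v
    have h2 := h.wl_sw hs (u * v)
    rw [mul_assoc] at huv
    have := ih u v hu' (by omega) c hc y hy
    rw [mul_assoc, mul_assoc]
    exact h.up hs (by omega) ha this

theorem mulD (h : DS S D) {u v : W} (huv : wordLen S (u * v) = wordLen S u + wordLen S v)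
    {x y : G} (hx : x ∈ D u) (hy : y ∈ D v) : x * y ∈ D (u * v) :=
  h.mulD_aux _ u v rfl huv x hx y hy

/-- right-handed length additivity -/
theorem mlenR (h : DS S D) {I J : Set W} (hJ : J ⊆ S) {u : W}
    (hc : ∀ s ∈ J, u * s * u⁻¹ ∈ I)
    (hu : ∀ x ∈ Subgroup.closure I, wordLen S u ≤ wordLen S (x * u)) {x : W}
    (hx : x ∈ Subgroup.closure J) :
    wordLen S (u * x) = wordLen S u + wordLen S x := by
  have hcl : ∀ y ∈ Subgroup.closure J, u * y * u⁻¹ ∈ Subgroup.closure I := by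
    intro y hy
    have : Subgroup.closure J ≤ (Subgroup.closure I).comap (MulAut.conj u).toMonoidHom := by
      rw [Subgroup.closure_le]
      intro s hs
      exact Subgroup.subset_closure (hc s hs)
    exact this hy
  have := h.mlen hJ (u := u⁻¹) (x := x⁻¹) (by
    intro y hy
    have := hu _ (hcl _ (inv_mem hy))
    rw [inv_mul_cancel_right] at this
    rw [h.wl_inv, ← h.wl_inv (y * _)]
    simpa using this) (inv_mem hx)
  rw [← mul_inv_rev, h.wl_inv, h.wl_inv, h.wl_inv] at this
  omega

/-- the parabolic -/
theorem stab (h : DS S D) {I : Set W} (hI : I ⊆ S) {X : Set G}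
    (h1 : ∀ x ∈ D 1, ∀ y ∈ X, x * y ∈ X) (h2 : ∀ s ∈ I, ∀ x ∈ D s, ∀ y ∈ X, x * y ∈ X)
    {w : W} (hw : w ∈ Subgroup.closure I) : ∀ x ∈ D w, ∀ y ∈ X, x * y ∈ X := by
  obtain ⟨L, hL, rfl⟩ := closure_list (h.invI hI) hw
  clear hw
  induction L with
  | nil => simpa using h1
  | cons s L ih =>
    intro x hx y hy
    rw [List.prod_cons] at hx
    obtain ⟨a, ha, c, hc, rfl⟩ := h.sub _ _ _ hx
    rw [mul_assoc]
    exact h2 s (hL s (by simp)) a ha _ (ih (fun y hy => hL y (by simp [hy])) c hc y hy)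

theorem stab_para (h : DS S D) {I : Set W} (hI : I ⊆ S)
    {w : W} (hw : w ∈ Subgroup.closure I) : ∀ x ∈ D w, ∀ y ∈ {g | ∃ w ∈ Subgroup.closure I, g ∈ D w},
      x * y ∈ {g | ∃ w ∈ Subgroup.closure I, g ∈ D w} := by
  apply h.stab hI _ _ hw
  · rintro x hx y ⟨v, hv, hy⟩
    exact ⟨v, hv, h.l1 _ _ hx _ hy⟩
  · rintro s hs x hx y ⟨v, hv, hy⟩
    rcases h.ax1 s (hI hs) v x hx y hy with h1 | h1
    · exact ⟨_, mul_mem (Subgroup.subset_closure hs) hv, h1⟩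
    · exact ⟨_, hv, h1⟩

/-- Parabolic subgroup. -/
def Par (h : DS S D) {I : Set W} (hI : I ⊆ S) : Subgroup G where
  carrier := {g | ∃ w ∈ Subgroup.closure I, g ∈ D w}
  one_mem' := ⟨1, one_mem _, h.one⟩
  mul_mem' := by
    rintro a b ⟨w, hw, ha⟩ hb
    exact h.stab_para hI hw a ha b hb
  inv_mem' := by
    rintro a ⟨w, hw, ha⟩
    exact ⟨w⁻¹, inv_mem hw, h.Dinv _ _ ha⟩

theorem mem_Par (h : DS S D) {I : Set W} (hI : I ⊆ S) {g : G} :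
    g ∈ h.Par hI ↔ ∃ w ∈ Subgroup.closure I, g ∈ D w := Iff.rfl

/-- `P D(u) Q = D(u) Q`. -/
theorem absorb (h : DS S D) {I J : Set W} (hI : I ⊆ S) (hJ : J ⊆ S) {u : W}
    (hc : ∀ s ∈ I, u⁻¹ * s * u ∈ J) {p g : G} (hp : p ∈ h.Par hI)
    (hg : g ∈ D u * (h.Par hJ : Set G)) : p * g ∈ D u * (h.Par hJ : Set G) := by
  obtain ⟨w, hw, hp⟩ := hp
  refine h.stab hI ?_ ?_ hw p hp g hg
  · rintro x hx _ ⟨d, hd, q, hq, rfl⟩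
    exact ⟨x * d, h.l1 _ _ hx _ hd, q, hq, mul_assoc _ _ _⟩
  · rintro s hs x hx _ ⟨d, hd, q, hq, rfl⟩
    rcases h.ax1 s (hI hs) u x hx d hd with h1 | h1
    · have e : s * u = u * (u⁻¹ * s * u) := by group
      rw [e] at h1
      obtain ⟨a, ha, c, hcc, hac⟩ := h.sub _ _ _ h1
      refine ⟨a, ha, c * q, mul_mem ⟨_, Subgroup.subset_closure (hc s hs), hcc⟩ hq, ?_⟩
      simp only
      rw [← mul_assoc, hac, mul_assoc]
    · exact ⟨x * d, h1, q, hq, mul_assoc _ _ _⟩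

end
end DS

/-- indicator in the group algebra -/
noncomputable def ind {G : Type*} [Group G] [Fintype G] (X : Set G) : MonoidAlgebra ℂ G :=
  ∑ x ∈ (Set.toFinite X).toFinset, MonoidAlgebra.single x (1 : ℂ)

theorem ind_conv {G : Type*} [Group G] [Fintype G] (B : Subgroup G) {X Y Z : Set G}
    (hX : ∀ x ∈ X, ∀ b ∈ B, x * b ∈ X) (hY : ∀ b ∈ B, ∀ y ∈ Y, b * y ∈ Y)
    (hXY : ∀ x ∈ X, ∀ y ∈ Y, x * y ∈ Z) (hZ : ∀ z ∈ Z, ∃ x ∈ X, ∃ y ∈ Y, x * y = z)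
    (hu : ∀ x ∈ X, ∀ y ∈ Y, ∀ x' ∈ X, ∀ y' ∈ Y, x * y = x' * y' → x⁻¹ * x' ∈ B) :
    ind X * ind Y = ((B : Set G).ncard : ℂ) • ind Z := by
  classical
  unfold ind
  rw [Finset.sum_mul_sum, ← Finset.sum_product']
  simp only [MonoidAlgebra.single_mul_single, one_mul]
  rw [← Finset.sum_fiberwise_of_maps_to (t := (Set.toFinite Z).toFinset)
    (g := fun p : G × G => p.1 * p.2) (by
      rintro ⟨x, y⟩ hp
      simp only [Finset.mem_product, Set.Finite.mem_toFinset] at hp ⊢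
      exact hXY x hp.1 y hp.2), Finset.smul_sum]
  refine Finset.sum_congr rfl fun z hz => ?_
  rw [Finset.sum_congr rfl (g := fun _ => MonoidAlgebra.single z (1 : ℂ)) (by
    intro p hp
    rw [(Finset.mem_filter.1 hp).2]), Finset.sum_const, ← Nat.cast_smul_eq_nsmul ℂ]
  congr 2
  rw [Set.Finite.mem_toFinset] at hz
  obtain ⟨x, hx, y, hy, rfl⟩ := hZ z hz
  rw [Set.ncard_eq_toFinset_card _ (Set.toFinite _)]
  symm
  refine Finset.card_bij (fun b _ => (x * b, b⁻¹ * y)) ?_ ?_ ?_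
  · intro b hb
    simp only [Set.Finite.mem_toFinset, SetLike.mem_coe] at hb
    simp only [Finset.mem_filter, Finset.mem_product, Set.Finite.mem_toFinset]
    exact ⟨⟨hX x hx b hb, hY _ (inv_mem hb) y hy⟩, by group⟩
  · intro a _ b _ hab
    simpa using (Prod.ext_iff.1 hab).1
  · rintro ⟨x', y'⟩ hp
    simp only [Finset.mem_filter, Finset.mem_product, Set.Finite.mem_toFinset] at hp
    obtain ⟨⟨hx', hy'⟩, e⟩ := hp
    refine ⟨x⁻¹ * x', ?_, ?_⟩
    · simpa using hu x hx y hy x' hx' y' hy' e.symm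
    · ext
      · simp
      · simp [mul_assoc, ← e]

namespace DS
section
variable {W G : Type*} [Group W] [Group G] [Fintype G] {S : Set W} {D : W → Set G}

theorem r1 (h : DS S D) {w : W} {x y : G} (hx : x ∈ D w) (hy : y ∈ D 1) : x * y ∈ D w := by
  have := h.l1 _ y⁻¹ (by simpa using h.Dinv _ _ hy) _ (h.Dinv _ _ hx)
  simpa using h.Dinv _ _ this

theorem Ts (h : DS S D) (B : Subgroup G) (hB : ∀ g, g ∈ B ↔ g ∈ D 1) {s v : W} (hs : s ∈ S)
    (hl : wordLen S v ≤ wordLen S (s * v)) :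
    ind (D s) * ind (D v) = ((B : Set G).ncard : ℂ) • ind (D (s * v)) := by
  apply ind_conv
  · exact fun x hx b hb => h.r1 hx ((hB b).1 hb)
  · exact fun b hb y hy => h.l1 _ _ ((hB b).1 hb) _ hy
  · exact fun x hx y hy => h.up hs hl hx hy
  · exact fun z hz => h.sub _ _ _ hz
  · intro x hx y hy x' hx' y' hy' e
    rw [hB]
    have hxi := h.Dinv _ _ hx
    rw [h.sinv hs] at hxi
    rcases h.ax1 s hs s _ hxi _ hx' with h1 | h1
    · rwa [h.inv s hs] at h1
    · exfalso
      have := h.up hs hl h1 hy'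
      rw [mul_assoc, ← e, inv_mul_cancel_left] at this
      exact h.ne1 s hs (mul_eq_right.1 (h.inj this hy))

theorem B_ne (B : Subgroup G) : ((B : Set G).ncard : ℂ) ≠ 0 := by
  have : 0 < (B : Set G).ncard := (Set.ncard_pos (Set.toFinite _)).2 ⟨1, B.one_mem⟩
  exact_mod_cast this.ne'

theorem T_aux (h : DS S D) (B : Subgroup G) (hB : ∀ g, g ∈ B ↔ g ∈ D 1) (n : ℕ) :
    ∀ u v : W, wordLen S u = n → wordLen S (u * v) = wordLen S u + wordLen S v →
    ind (D u) * ind (D v) = ((B : Set G).ncard : ℂ) • ind (D (u * v)) := by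
  induction n with
  | zero =>
    intro u v hu _
    have := h.wl_zero hu
    subst this
    rw [one_mul]
    apply ind_conv
    · exact fun x hx b hb => h.r1 hx ((hB b).1 hb)
    · exact fun b hb y hy => h.l1 _ _ ((hB b).1 hb) _ hy
    · exact fun x hx y hy => h.l1 _ _ hx _ hy
    · exact fun z hz => ⟨1, h.one, z, hz, one_mul _⟩
    · intro x hx y hy x' hx' y' hy' e
      exact mul_mem (inv_mem ((hB _).2 hx)) ((hB _).2 hx')
  | succ n ih =>
    intro u v hu huv
    obtain ⟨s, hs, u, rfl, hu'⟩ := h.peelL hu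
    have h1 := h.wl_mul u v
    have h2 := h.wl_sw hs (u * v)
    rw [mul_assoc] at huv
    have IH := ih u v hu' (by omega)
    have e1 := h.Ts B hB (v := u) hs (by omega)
    have e2 := h.Ts B hB (v := u * v) hs (by omega)
    have hb := B_ne B
    apply smul_right_injective _ hb
    simp only
    rw [← smul_mul_assoc, ← e1, mul_assoc, IH, mul_smul_comm, e2, mul_assoc]

theorem T (h : DS S D) (B : Subgroup G) (hB : ∀ g, g ∈ B ↔ g ∈ D 1) {u v : W}
    (huv : wordLen S (u * v) = wordLen S u + wordLen S v) :
    ind (D u) * ind (D v) = ((B : Set G).ncard : ℂ) • ind (D (u * v)) :=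
  h.T_aux B hB _ u v rfl huv

theorem TQ (h : DS S D) (B : Subgroup G) (hB : ∀ g, g ∈ B ↔ g ∈ D 1) {J : Set W} (hJ : J ⊆ S)
    {u : W} (hu : ∀ x ∈ Subgroup.closure J, wordLen S (u * x) = wordLen S u + wordLen S x) :
    ind (D u) * ind (h.Par hJ : Set G) =
      ((B : Set G).ncard : ℂ) • ind (D u * (h.Par hJ : Set G)) := by
  have hBP : ∀ b ∈ B, b ∈ h.Par hJ := fun b hb => ⟨1, one_mem _, (hB b).1 hb⟩
  apply ind_conv
  · exact fun x hx b hb => h.r1 hx ((hB b).1 hb)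
  · exact fun b hb y hy => mul_mem (hBP b hb) hy
  · exact fun x hx y hy => ⟨x, hx, y, hy, rfl⟩
  · rintro z ⟨x, hx, y, hy, e⟩
    exact ⟨x, hx, y, hy, e⟩
  · intro x hx y hy x' hx' y' hy' e
    have e' : x⁻¹ * x' = y * y'⁻¹ := by
      rw [inv_mul_eq_iff_eq_mul, ← mul_assoc, e]; group
    have hq : x⁻¹ * x' ∈ h.Par hJ := by
      rw [e']
      exact mul_mem hy (inv_mem hy')
    obtain ⟨w, hw, hxw⟩ := hq
    have := h.mulD (hu w hw) hx hxw
    rw [mul_inv_cancel_left] at this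
    have := h.inj this hx'
    rw [mul_eq_left.1 this] at hxw
    exact (hB _).2 hxw

theorem step (h : DS S D) (B : Subgroup G) (hB : ∀ g, g ∈ B ↔ g ∈ D 1) {J K : Set W} (hJ : J ⊆ S)
    (hK : K ⊆ S) {u v : W}
    (hu : ∀ x ∈ Subgroup.closure J, wordLen S (u * x) = wordLen S u + wordLen S x)
    (hv : ∀ x ∈ Subgroup.closure K, wordLen S (v * x) = wordLen S v + wordLen S x)
    (huv' : ∀ x ∈ Subgroup.closure K, wordLen S (u * v * x) = wordLen S (u * v) + wordLen S x)
    (huv : wordLen S (u * v) = wordLen S u + wordLen S v)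
    (hc : ∀ s ∈ J, v⁻¹ * s * v ∈ K) :
    (((h.Par hJ : Set G).ncard : ℂ)⁻¹ • ind (D u * (h.Par hJ : Set G))) *
      (((h.Par hK : Set G).ncard : ℂ)⁻¹ • ind (D v * (h.Par hK : Set G))) =
      ((h.Par hK : Set G).ncard : ℂ)⁻¹ • ind (D (u * v) * (h.Par hK : Set G)) := by
  have hb := B_ne B
  have hq := B_ne (h.Par hJ)
  have e1 := h.TQ B hB hJ hu
  have e2 := h.TQ B hB hK hv
  have e3 := h.TQ B hB hK huv'
  have e4 := h.T B hB huv
  have e5 : ind (h.Par hJ : Set G) * ind (D v * (h.Par hK : Set G)) =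
      ((h.Par hJ : Set G).ncard : ℂ) • ind (D v * (h.Par hK : Set G)) := by
    apply ind_conv
    · exact fun x hx b hb => mul_mem hx hb
    · exact fun b hb y hy => h.absorb hJ hK hc hb hy
    · exact fun b hb y hy => h.absorb hJ hK hc hb hy
    · exact fun z hz => ⟨1, one_mem _, z, hz, one_mul _⟩
    · intro x hx y hy x' hx' y' hy' e
      exact mul_mem (inv_mem hx) hx'
  rw [smul_mul_smul_comm, mul_comm, mul_smul]
  congr 1
  apply smul_right_injective _ hb
  apply smul_right_injective _ hb
  simp only
  rw [← e3, smul_comm _ (_⁻¹), ← smul_mul_assoc _ (ind (D u * _)), ← e1, mul_assoc, e5,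
    mul_smul_comm, inv_smul_smul₀ hq, ← mul_smul_comm, ← e2, ← mul_assoc, e4, smul_mul_assoc]

end
end DS

namespace DS
section
variable {W G : Type*} [Group W] [Group G] [Fintype G] {S : Set W} {D : W → Set G}

/-- normalized indicator of `D(u) P_J` -/
noncomputable def Am (D : W → Set G) (u : W) (J : Set W) : MonoidAlgebra ℂ G :=
  (({g : G | ∃ w ∈ Subgroup.closure J, g ∈ D w}.ncard : ℂ))⁻¹ •
    ind (D u * {g : G | ∃ w ∈ Subgroup.closure J, g ∈ D w})

theorem wl_prod (h : DS S D) (k : ℕ) (u : ℕ → W) :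
    wordLen S (((List.range k).map (fun i => u (i + 1))).prod) ≤
      ∑ i ∈ Finset.range k, wordLen S (u (i + 1)) := by
  induction k with
  | zero => simp [h.wl_one]
  | succ k ih =>
    rw [List.range_succ, List.map_append, List.prod_append, Finset.sum_range_succ]
    refine (h.wl_mul _ _).trans ?_
    simpa using ih

theorem main (h : DS S D) (B : Subgroup G) (hB : ∀ g, g ∈ B ↔ g ∈ D 1) (k : ℕ) :
    ∀ (u : ℕ → W) (I : ℕ → Set W), (∀ i ≤ k + 1, I i ⊆ S) →
    (∀ i < k + 1, ∀ s ∈ I i, (u (i + 1))⁻¹ * s * u (i + 1) ∈ I (i + 1)) →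
    (∀ i < k + 1, ∀ s ∈ I (i + 1), u (i + 1) * s * (u (i + 1))⁻¹ ∈ I i) →
    (∀ i < k + 1, ∀ x ∈ Subgroup.closure (I i),
      wordLen S (u (i + 1)) ≤ wordLen S (x * u (i + 1))) →
    (wordLen S (((List.range (k + 1)).map (fun i => u (i + 1))).prod) =
      ∑ i ∈ Finset.range (k + 1), wordLen S (u (i + 1))) →
    (∀ s ∈ I 0, (((List.range (k + 1)).map (fun i => u (i + 1))).prod)⁻¹ * s *
      ((List.range (k + 1)).map (fun i => u (i + 1))).prod ∈ I (k + 1)) ∧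
    (∀ s ∈ I (k + 1), (((List.range (k + 1)).map (fun i => u (i + 1))).prod) * s *
      (((List.range (k + 1)).map (fun i => u (i + 1))).prod)⁻¹ ∈ I 0) ∧
    (∀ x ∈ Subgroup.closure (I 0),
      wordLen S (((List.range (k + 1)).map (fun i => u (i + 1))).prod) ≤
        wordLen S (x * ((List.range (k + 1)).map (fun i => u (i + 1))).prod)) ∧
    ((List.range (k + 1)).map (fun i => Am D (u (i + 1)) (I (i + 1)))).prod =
      Am D (((List.range (k + 1)).map (fun i => u (i + 1))).prod) (I (k + 1)) := by
  induction k with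
  | zero =>
    intro u I hI h1 h2 h3 _
    have a1 := h1 0 (by omega)
    have a2 := h2 0 (by omega)
    have a3 := h3 0 (by omega)
    simp at a1 a2 a3 ⊢
    exact ⟨a1, a2, a3⟩
  | succ k ih =>
    intro u I hI h1 h2 h3 hadd
    have IH := ih (fun i => u (i + 1)) (fun i => I (i + 1)) (fun i hi => hI _ (by omega))
      (fun i hi => h1 _ (by omega)) (fun i hi => h2 _ (by omega)) (fun i hi => h3 _ (by omega))
    have eL : ∀ {M : Type _} [Monoid M] (f : ℕ → M), ((List.range (k + 1 + 1)).map f).prod =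
        f 0 * ((List.range (k + 1)).map (fun i => f (i + 1))).prod := by
      intro M _ f
      rw [List.range_succ_eq_map, List.map_cons, List.prod_cons, List.map_map]
      rfl
    have eL2 : ∀ {M : Type _} [Monoid M] (f : ℕ → M), ((List.range (k + 1 + 1)).map f).prod =
        f 0 * ((List.range (k + 1)).map (fun i => f (i + 1))).prod := by
      intro M _ f
      rw [List.range_succ_eq_map, List.map_cons, List.prod_cons, List.map_map]
      rfl
    rw [eL, Finset.sum_range_succ'] at hadd
    rw [eL, eL2]
    have hle := h.wl_prod (k + 1) (fun i => u (i + 1))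
    simp only [zero_add] at hadd hle IH ⊢
    set v := ((List.range (k + 1)).map (fun i => u (i + 1 + 1))).prod with hv
    have hm := h.wl_mul (u 1) v
    obtain ⟨b1, b2, b3, b4⟩ := IH (by omega)
    have a1 := h1 0 (by omega)
    have a2 := h2 0 (by omega)
    have a3 := h3 0 (by omega)
    simp only [zero_add] at a1 a2 a3
    have c1 : ∀ s ∈ I 0, (u 1 * v)⁻¹ * s * (u 1 * v) ∈ I (k + 1 + 1) := by
      intro s hs
      have := b1 _ (a1 s hs)
      convert this using 1
      group
    have c2 : ∀ s ∈ I (k + 1 + 1), (u 1 * v) * s * (u 1 * v)⁻¹ ∈ I 0 := by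
      intro s hs
      have := a2 _ (b2 s hs)
      convert this using 1
      group
    have c3 := h.part1 (hI 0 (by omega)) a1 a3 b3
    refine ⟨c1, c2, c3, ?_⟩
    rw [b4]
    have hJ := hI 1 (by omega)
    have hK := hI (k + 1 + 1) (by omega)
    exact h.step B hB hJ hK (fun x hx => h.mlenR hJ a2 a3 hx) (fun x hx => h.mlenR hK b2 b3 hx)
      (fun x hx => h.mlenR hK c2 c3 hx) (by omega) b1

end
end DS

theorem lifts_mul (B N : Subgroup G) [((B ⊓ N).subgroupOf N).Normal]
    {w v : ↥N ⧸ (B ⊓ N).subgroupOf N} {x y : G} (hx : x ∈ lifts B N w) (hy : y ∈ lifts B N v) :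
    x * y ∈ lifts B N (w * v) := by
  obtain ⟨a, rfl, rfl⟩ := hx
  obtain ⟨b, rfl, rfl⟩ := hy
  exact ⟨a * b, rfl, rfl⟩

theorem lifts_inv (B N : Subgroup G) [((B ⊓ N).subgroupOf N).Normal]
    {w : ↥N ⧸ (B ⊓ N).subgroupOf N} {x : G} (hx : x ∈ lifts B N w) :
    x⁻¹ ∈ lifts B N w⁻¹ := by
  obtain ⟨a, rfl, rfl⟩ := hx
  exact ⟨a⁻¹, rfl, rfl⟩

theorem lifts_ne (B N : Subgroup G) (w : ↥N ⧸ (B ⊓ N).subgroupOf N) :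
    ∃ x, x ∈ lifts B N w := by
  obtain ⟨a, rfl⟩ := QuotientGroup.mk_surjective w
  exact ⟨a, a, rfl, rfl⟩

theorem lifts_one (B N : Subgroup G) [((B ⊓ N).subgroupOf N).Normal]
    {w : ↥N ⧸ (B ⊓ N).subgroupOf N} {x : G} (hx : x ∈ lifts B N w) : x ∈ B ↔ w = 1 := by
  obtain ⟨a, rfl, rfl⟩ := hx
  rw [QuotientGroup.eq_one_iff, Subgroup.mem_subgroupOf]
  simp

theorem mem_BwB (B N : Subgroup G) {w : ↥N ⧸ (B ⊓ N).subgroupOf N} {g : G} :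
    g ∈ BwB B N w ↔ ∃ b ∈ B, ∃ n ∈ lifts B N w, ∃ c ∈ B, b * n * c = g := by
  simp only [BwB, Set.mem_mul, SetLike.mem_coe]
  constructor
  · rintro ⟨_, ⟨b, hb, n, hn, rfl⟩, c, hc, rfl⟩
    exact ⟨b, hb, n, hn, c, hc, rfl⟩
  · rintro ⟨b, hb, n, hn, c, hc, rfl⟩
    exact ⟨_, ⟨b, hb, n, hn, rfl⟩, c, hc, rfl⟩

theorem BwB_lr (B N : Subgroup G) {w : ↥N ⧸ (B ⊓ N).subgroupOf N} {b g c : G} (hb : b ∈ B)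
    (hg : g ∈ BwB B N w) (hc : c ∈ B) : b * g * c ∈ BwB B N w := by
  rw [mem_BwB] at hg ⊢
  obtain ⟨b', hb', n, hn, c', hc', rfl⟩ := hg
  exact ⟨b * b', mul_mem hb hb', n, hn, c' * c, mul_mem hc' hc, by group⟩

theorem lift_mem (B N : Subgroup G) {w : ↥N ⧸ (B ⊓ N).subgroupOf N} {g : G}
    (hg : g ∈ lifts B N w) : g ∈ BwB B N w :=
  (mem_BwB B N).2 ⟨1, one_mem _, g, hg, 1, one_mem _, by simp⟩

/-- two lifts differ by an element of `B` on the right -/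
theorem lifts_two (B N : Subgroup G) [((B ⊓ N).subgroupOf N).Normal]
    {w : ↥N ⧸ (B ⊓ N).subgroupOf N} {x y : G} (hx : x ∈ lifts B N w) (hy : y ∈ lifts B N w) :
    ∃ b ∈ B, y = x * b := by
  refine ⟨x⁻¹ * y, ?_, by group⟩
  have := lifts_mul B N (lifts_inv B N hx) hy
  rw [lifts_one B N this]
  simp

theorem BwB_sub (B N : Subgroup G) [((B ⊓ N).subgroupOf N).Normal]
    {w v : ↥N ⧸ (B ⊓ N).subgroupOf N} {g : G} (h1 : g ∈ BwB B N w) (h2 : g ∈ BwB B N v) :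
    BwB B N w ⊆ BwB B N v := by
  rintro y hy
  obtain ⟨b, hb, n, hn, c, hc, rfl⟩ := (mem_BwB B N).1 h1
  obtain ⟨b', hb', n', hn', c', hc', rfl⟩ := (mem_BwB B N).1 hy
  obtain ⟨t, ht, rfl⟩ := lifts_two B N hn hn'
  have := BwB_lr B N (mul_mem hb' (inv_mem hb)) h2 (mul_mem (inv_mem hc) (mul_mem ht hc'))
  convert this using 1
  group

theorem BwB_one (B N : Subgroup G) [((B ⊓ N).subgroupOf N).Normal] (g : G) :
    g ∈ B ↔ g ∈ BwB B N 1 := by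
  rw [mem_BwB]
  constructor
  · intro hg
    exact ⟨g, hg, 1, ⟨1, rfl, rfl⟩, 1, one_mem _, by simp⟩
  · rintro ⟨b, hb, n, hn, c, hc, rfl⟩
    exact mul_mem (mul_mem hb ((lifts_one B N hn).2 rfl)) hc

theorem mkDS (B N : Subgroup G) [((B ⊓ N).subgroupOf N).Normal]
    (S : Set (↥N ⧸ (B ⊓ N).subgroupOf N))
    (hSgen : Subgroup.closure S = ⊤)
    (hSinv : ∀ s ∈ S, s * s = 1 ∧ s ≠ 1)
    (hBN1 : ∀ s ∈ S, ∀ w : ↥N ⧸ (B ⊓ N).subgroupOf N,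
      lifts B N s * (B : Set G) * lifts B N w ⊆ BwB B N (s * w) ∪ BwB B N w)
    (hBN2 : ∀ s ∈ S, ¬(lifts B N s * (B : Set G) * lifts B N s ⊆ (B : Set G))) :
    DS S (BwB B N) where
  gen := hSgen
  inv := fun s hs => (hSinv s hs).1
  ne1 := fun s hs => (hSinv s hs).2
  one := (BwB_one B N 1).1 (one_mem _)
  Dinv := by
    intro w g hg
    obtain ⟨b, hb, n, hn, c, hc, rfl⟩ := (mem_BwB B N).1 hg
    exact (mem_BwB B N).2 ⟨c⁻¹, inv_mem hc, n⁻¹, lifts_inv B N hn, b⁻¹, inv_mem hb, by group⟩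
  ne := by
    intro w
    obtain ⟨x, hx⟩ := lifts_ne B N w
    exact ⟨x, lift_mem B N hx⟩
  eq := fun g w v h1 h2 => (BwB_sub B N h1 h2).antisymm (BwB_sub B N h2 h1)
  sub := by
    intro g w v hg
    obtain ⟨b, hb, n, hn, c, hc, rfl⟩ := (mem_BwB B N).1 hg
    obtain ⟨x, hx⟩ := lifts_ne B N w
    refine ⟨b * x * 1, BwB_lr B N hb (lift_mem B N hx) (one_mem _), 1 * (x⁻¹ * n) * c, ?_, by group⟩
    refine BwB_lr B N (one_mem _) (lift_mem B N ?_) hc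
    simpa using lifts_mul B N (lifts_inv B N hx) hn
  d1 := by
    intro w hw
    obtain ⟨x, hx⟩ := lifts_ne B N w
    have := lift_mem B N hx
    rw [hw, ← BwB_one] at this
    exact (lifts_one B N hx).1 this
  ax1 := by
    intro s hs w x hx y hy
    obtain ⟨b, hb, n, hn, c, hc, rfl⟩ := (mem_BwB B N).1 hx
    obtain ⟨b', hb', n', hn', c', hc', rfl⟩ := (mem_BwB B N).1 hy
    have e : b * n * c * (b' * n' * c') = b * (n * (c * b') * n') * c' := by group
    rw [e]
    rcases hBN1 s hs w ⟨_, ⟨n, hn, c * b', mul_mem hc hb', rfl⟩, n', hn', rfl⟩ with h1 | h1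
    · exact Or.inl (BwB_lr B N hb h1 hc')
    · exact Or.inr (BwB_lr B N hb h1 hc')
  ax2 := by
    intro s hs
    obtain ⟨_, ⟨_, ⟨n, hn, b, hb, rfl⟩, n', hn', rfl⟩, h2⟩ := Set.not_subset.1 (hBN2 s hs)
    refine ⟨1 * n * b, BwB_lr B N (one_mem _) (lift_mem B N hn) hb, n', lift_mem B N hn', ?_⟩
    rw [← BwB_one, one_mul]
    exact h2
  l1 := by
    intro w x hx y hy
    have := BwB_lr B N ((BwB_one B N x).2 hx) hy (one_mem B)
    simpa using this

theorem aPwQ_eq [Fintype G] (B N : Subgroup G) [((B ⊓ N).subgroupOf N).Normal]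
    {S : Set (↥N ⧸ (B ⊓ N).subgroupOf N)} (h : DS S (BwB B N))
    {I J : Set (↥N ⧸ (B ⊓ N).subgroupOf N)} (hI : I ⊆ S) (hJ : J ⊆ S)
    {u : ↥N ⧸ (B ⊓ N).subgroupOf N} (hc : ∀ s ∈ I, u⁻¹ * s * u ∈ J) :
    aPwQ B N (para B N I) u (para B N J) = DS.Am (BwB B N) u J := by
  have e : para B N I * lifts B N u * para B N J = BwB B N u * para B N J := by
    apply Set.Subset.antisymm
    · rintro _ ⟨_, ⟨p, hp, n, hn, rfl⟩, q, hq, rfl⟩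
      have := h.absorb hI hJ hc (p := p) (g := n * q) hp ⟨n, lift_mem B N hn, q, hq, rfl⟩
      simp only
      rw [mul_assoc]
      exact this
    · rintro _ ⟨x, hx, q, hq, rfl⟩
      obtain ⟨b, hb, n, hn, c, hc, rfl⟩ := (mem_BwB B N).1 hx
      refine ⟨b * n, ⟨b, ⟨1, one_mem _, (BwB_one B N b).1 hb⟩, n, hn, rfl⟩, c * q, ?_, ?_⟩
      · have hc' : c ∈ h.Par hJ := ⟨1, one_mem _, (BwB_one B N c).1 hc⟩
        exact (h.Par hJ).mul_mem hc' hq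
      · simp only [mul_assoc]
  unfold aPwQ
  simp only [e]
  rfl

theorem stmt_7 [Fintype G] (B N : Subgroup G) [((B ⊓ N).subgroupOf N).Normal]
    -- BN-pair axioms
    (hGN : Subgroup.closure ((B : Set G) ∪ (N : Set G)) = ⊤)
    (S : Set (↥N ⧸ (B ⊓ N).subgroupOf N))
    (hSgen : Subgroup.closure S = ⊤)
    (hSinv : ∀ s ∈ S, s * s = 1 ∧ s ≠ 1)
    (hBN1 : ∀ s ∈ S, ∀ w : ↥N ⧸ (B ⊓ N).subgroupOf N,
      lifts B N s * (B : Set G) * lifts B N w ⊆ BwB B N (s * w) ∪ BwB B N w)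
    (hBN2 : ∀ s ∈ S, ¬(lifts B N s * (B : Set G) * lifts B N s ⊆ (B : Set G)))
    -- the data of the statement: u₁, …, u_k and I₀, …, I_k
    (k : ℕ) (hk : 1 ≤ k)
    (u : ℕ → ↥N ⧸ (B ⊓ N).subgroupOf N)
    (I : ℕ → Set (↥N ⧸ (B ⊓ N).subgroupOf N))
    (hIS : ∀ i ≤ k, I i ⊆ S)
    (hconj : ∀ i, 1 ≤ i → i ≤ k → (fun x => (u i)⁻¹ * x * u i) '' I (i - 1) = I i)
    (hmin : ∀ i, 1 ≤ i → i ≤ k → ∀ x ∈ Subgroup.closure (I (i - 1)),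
      wordLen S (u i) ≤ wordLen S (x * u i))
    (hadd : wordLen S (((List.range k).map (fun i => u (i + 1))).prod) =
      ∑ i ∈ Finset.range k, wordLen S (u (i + 1))) :
    (∀ x ∈ Subgroup.closure (I 0),
      wordLen S (((List.range k).map (fun i => u (i + 1))).prod) ≤
        wordLen S (x * ((List.range k).map (fun i => u (i + 1))).prod)) ∧
    ((List.range k).map
        (fun i => aPwQ B N (para B N (I i)) (u (i + 1)) (para B N (I (i + 1))))).prod =
      aPwQ B N (para B N (I 0)) (((List.range k).map (fun i => u (i + 1))).prod)
        (para B N (I k)) := by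
  have h := mkDS B N S hSgen hSinv hBN1 hBN2
  obtain ⟨k, rfl⟩ : ∃ m, k = m + 1 := ⟨k - 1, by omega⟩
  have h1 : ∀ i < k + 1, ∀ s ∈ I i, (u (i + 1))⁻¹ * s * u (i + 1) ∈ I (i + 1) := by
    intro i hi s hs
    rw [← hconj (i + 1) (by omega) (by omega)]
    exact ⟨s, hs, rfl⟩
  have h2 : ∀ i < k + 1, ∀ s ∈ I (i + 1), u (i + 1) * s * (u (i + 1))⁻¹ ∈ I i := by
    intro i hi s hs
    rw [← hconj (i + 1) (by omega) (by omega)] at hs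
    obtain ⟨t, ht, rfl⟩ := hs
    simp only [Nat.add_sub_cancel] at ht
    convert ht using 1
    group
  obtain ⟨c1, -, c3, c4⟩ := h.main B (BwB_one B N) k u I hIS h1 h2
    (fun i hi => hmin (i + 1) (by omega) (by omega)) hadd
  refine ⟨c3, ?_⟩
  rw [aPwQ_eq B N h (hIS 0 (by omega)) (hIS (k + 1) le_rfl) c1, ← c4]
  congr 1
  apply List.map_congr_left
  intro i hi
  have hi' := List.mem_range.1 hi
  exact aPwQ_eq B N h (hIS i (by omega)) (hIS (i + 1) (by omega)) (h1 i hi')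
end
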